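/- arXiv:1811.10468 — 7 statements merged into one kernel-verified Lean document; each statement's English description precedes it below -/
import Mathlib

section
/- Let r ≥ 1, let O ⊆ ℝʳ be a bounded open set, and let Θ : O → ℝʳ be an injective C¹ map with det DΘ(h) ≠ 0 for every h ∈ O and with Θ(O) bounded. Set w(h) = |det DΘ(h)|⁻¹ for h ∈ O. Let f : ℝʳ → ℂ be continuous with compact support contained in O, let Λ ⊆ ℝʳ be a countable set and let m, M be constants with 0 < m ≤ M < ∞ such that m ≤ ∑_{ℓ ∈ Λ} |f(ℓ + h)|² w(ℓ + h) ≤ M for almost every h ∈ ℝʳ (terms with ℓ + h ∉ O being 0). Let ς > 0 satisfy Θ(O) ⊆ [-ς, ς)ʳ. For (ℓ, k) ∈ Λ × ℤʳ define g_{ℓ,k} ∈ L²(ℝʳ) by g_{ℓ,k}(h) = exp( 2πi ⟨Θ(ℓ + h), k⟩ / (2ς) ) · f(ℓ + h) when ℓ + h ∈ O and g_{ℓ,k}(h) = 0 otherwise. Then the family (g_{ℓ,k})_{(ℓ,k) ∈ Λ × ℤʳ} is a frame for L²(ℝʳ) with frame bounds m·(2ς)ʳ and M·(2ς)ʳ;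 that is, m(2ς)ʳ ‖g‖² ≤ ∑_{(ℓ,k)} |⟨g, g_{ℓ,k}⟩|² ≤ M(2ς)ʳ ‖g‖² for every g ∈ L²(ℝʳ). -/
open MeasureTheory

namespace Stmt8
open UnitAddTorus

noncomputable local instance instMS : MeasureSpace UnitAddCircle := ⟨AddCircle.haarAddCircle⟩
local instance instHaar : Measure.IsAddHaarMeasure (volume : Measure UnitAddCircle) :=
  inferInstanceAs (Measure.IsAddHaarMeasure AddCircle.haarAddCircle)
local instance instProb : IsProbabilityMeasure (volume : Measure UnitAddCircle) :=
  inferInstanceAs (IsProbabilityMeasure AddCircle.haarAddCircle)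

/-- the half-open unit cube -/
def cube (r : ℕ) : Set (Fin r → ℝ) := {x | ∀ i, x i ∈ Set.Ioc (-1/2 : ℝ) (-1/2 + 1)}

theorem mFourier_coe {r : ℕ} (k : Fin r → ℤ) (y : Fin r → ℝ) :
    mFourier k (fun i => (y i : UnitAddCircle)) =
      Complex.exp (2 * Real.pi * Complex.I * ((∑ j, y j * (k j : ℝ) : ℝ) : ℂ)) := by
  simp only [mFourier, ContinuousMap.coe_mk, fourier_coe_apply]
  rw [← Complex.exp_sum]
  congr 1
  push_cast
  rw [Finset.mul_sum]
  refine Finset.sum_congr rfl fun j _ => ?_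
  simp
  ring

theorem enorm_sq_ofReal (z : ℂ) : ‖z‖ₑ ^ 2 = ENNReal.ofReal (‖z‖ ^ 2) := by
  rw [ENNReal.ofReal_pow (norm_nonneg _), ofReal_norm]

theorem parseval {r : ℕ} (F : (Fin r → ℝ) → ℂ) (hF : Measurable F)
    (hfin : ∫⁻ y in cube r, ‖F y‖ₑ ^ 2 ≠ ⊤) :
    ∑' k : Fin r → ℤ, ‖∫ y in cube r,
      Complex.exp (2 * Real.pi * Complex.I * ((∑ j, y j * (k j : ℝ) : ℝ) : ℂ)) * F y‖ₑ ^ 2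
    = ∫⁻ y in cube r, ‖F y‖ₑ ^ 2 := by
  set s : UnitAddTorus (Fin r) → (Fin r → ℝ) :=
    fun t i => (AddCircle.equivIoc 1 (-1/2) (t i) : ℝ) with hs
  have hsm : Measurable s := by
    refine measurable_pi_lambda _ fun i => ?_
    exact (measurable_subtype_coe.comp (AddCircle.measurableEquivIoc 1 (-1/2)).measurable).comp
      (measurable_pi_apply i)
  have hcube : MeasurableSet (cube r) := by
    have : cube r = Set.univ.pi fun _ => Set.Ioc (-1/2 : ℝ) (-1/2 + 1) := by
      ext; simp [cube]
    rw [this]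
    exact MeasurableSet.univ_pi fun _ => measurableSet_Ioc
  have hsy : ∀ y ∈ cube r, s (fun i => (y i : UnitAddCircle)) = y := by
    intro y hy
    ext i
    simp only [hs]
    rw [AddCircle.equivIoc_coe_eq (hy i)]
  set G : UnitAddTorus (Fin r) → ℂ := fun t => F (s t) with hG
  have hGm : Measurable G := hF.comp hsm
  have hl : ∫⁻ t, ‖G t‖ₑ ^ 2 = ∫⁻ y in cube r, ‖F y‖ₑ ^ 2 := by
    rw [UnitAddTorus.lintegral_preimage _ (fun _ => (-1/2 : ℝ))]
    refine setLIntegral_congr_fun hcube fun y hy => ?_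
    simp only [hG, hsy y hy]
  have hGL : MemLp G 2 volume := by
    refine ⟨hGm.aestronglyMeasurable, ?_⟩
    rw [eLpNorm_lt_top_iff_lintegral_rpow_enorm_lt_top (by simp) (by simp)]
    simp only [ENNReal.toReal_ofNat, ENNReal.rpow_ofNat]
    rw [hl]; exact hfin.lt_top
  have hP := hasSum_sq_mFourierCoeff (hGL.toLp G)
  have hint : (∫ t, ‖(hGL.toLp G) t‖ ^ 2) = ∫ t, ‖G t‖ ^ 2 := by
    refine integral_congr_ae ?_
    filter_upwards [hGL.coeFn_toLp] with t ht
    rw [ht]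
  have hco : ∀ k, mFourierCoeff (hGL.toLp G) k = ∫ y in cube r,
      Complex.exp (2 * Real.pi * Complex.I * ((∑ j, y j * ((-k) j : ℝ) : ℝ) : ℂ)) * F y := by
    intro k
    have : mFourierCoeff (hGL.toLp G) k = mFourierCoeff G k := by
      refine integral_congr_ae ?_
      filter_upwards [hGL.coeFn_toLp] with t ht
      rw [ht]
    rw [this, mFourierCoeff_eq_integral _ _ (fun _ => (-1/2 : ℝ))]
    refine setIntegral_congr_fun hcube fun y hy => ?_
    simp only [hG, hsy y hy, mFourier_coe, smul_eq_mul]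
  rw [hint] at hP
  have hsum := hP.summable
  have htsum := hP.tsum_eq
  rw [← hl]
  have : ∫⁻ t, ‖G t‖ₑ ^ 2 = ENNReal.ofReal (∫ t, ‖G t‖ ^ 2) := by
    rw [ofReal_integral_eq_lintegral_ofReal]
    · simp only [enorm_sq_ofReal]
    · exact hGL.integrable_norm_pow (by norm_num)
    · exact Filter.Eventually.of_forall fun t => by positivity
  rw [this, ← htsum, ENNReal.ofReal_tsum_of_nonneg (fun _ => by positivity) hsum]
  rw [← (Equiv.neg (Fin r → ℤ)).tsum_eq]
  refine tsum_congr fun k => ?_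
  rw [hco, enorm_sq_ofReal]
  simp

theorem parseval_image {r : ℕ} {O : Set (Fin r → ℝ)} (hO : MeasurableSet O)
    {Ψ : (Fin r → ℝ) → (Fin r → ℝ)} {Ψ' : (Fin r → ℝ) → ((Fin r → ℝ) →L[ℝ] (Fin r → ℝ))}
    (hd : ∀ x ∈ O, HasFDerivWithinAt Ψ (Ψ' x) O x) (hinj : Set.InjOn Ψ O)
    (hdet : ∀ x ∈ O, (Ψ' x).det ≠ 0) (hcont : ContinuousOn (fun x => (Ψ' x).det) O)
    (hcube : Ψ '' O ⊆ Set.univ.pi fun _ => Set.Ico (-1/2 : ℝ) (1/2))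
    (v : (Fin r → ℝ) → ℂ) (hv : Measurable v)
    (hfin : ∫⁻ x in O, ‖v x‖ₑ ^ 2 * ENNReal.ofReal |(Ψ' x).det|⁻¹ ≠ ⊤) :
    ∑' k : Fin r → ℤ, ‖∫ x in O,
      Complex.exp (2 * Real.pi * Complex.I * ((∑ j, Ψ x j * (k j : ℝ) : ℝ) : ℂ)) * v x‖ₑ ^ 2
    = ∫⁻ x in O, ‖v x‖ₑ ^ 2 * ENNReal.ofReal |(Ψ' x).det|⁻¹ := by
  have hemb := measurableEmbedding_of_fderivWithin hO hd hinj
  have hq : Measurable (fun x : O => ((|(Ψ' x).det|⁻¹ : ℝ) : ℂ) * v x) := by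
    have h1 : Measurable (fun x : O => (Ψ' x).det) :=
      (continuousOn_iff_continuous_domRestrict.mp hcont).measurable
    have h2 : Measurable (fun x : O => v x) := hv.comp measurable_subtype_coe
    have h3 : Measurable (fun x : O => |(Ψ' x).det|⁻¹) := (measurable_norm.comp h1).inv
    exact (Complex.measurable_ofReal.comp h3).mul h2
  obtain ⟨F₀, hF₀, hF₀e⟩ := hemb.exists_measurable_extend hq (fun _ => ⟨0⟩)
  have hF₀v : ∀ x ∈ O, F₀ (Ψ x) = ((|(Ψ' x).det|⁻¹ : ℝ) : ℂ) * v x := fun x hx =>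
    congrFun hF₀e ⟨x, hx⟩
  have him : MeasurableSet (Ψ '' O) := by
    have := hemb.measurableSet_range
    rwa [Set.range_domRestrict] at this
  set F := (Ψ '' O).indicator F₀ with hFdef
  have hF : Measurable F := hF₀.indicator him
  have hcc : (cube r : Set _) =ᵐ[volume] (Set.univ.pi fun _ => Set.Ico (-1/2 : ℝ) (1/2) : Set _) := by
    have h1 : cube r = Set.univ.pi fun _ => Set.Ioc (-1/2 : ℝ) (1/2) := by
      ext; norm_num [cube]
    rw [h1]
    exact (Measure.univ_pi_Ioc_ae_eq_Icc (f := fun _ => (-1/2 : ℝ)) (g := fun _ => (1/2 : ℝ))).trans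
      (Measure.univ_pi_Ico_ae_eq_Icc (f := fun _ => (-1/2 : ℝ)) (g := fun _ => (1/2 : ℝ))).symm
  have hpos : ∀ x ∈ O, 0 < |(Ψ' x).det| := fun x hx => abs_pos.mpr (hdet x hx)
  have hL : ∫⁻ y in cube r, ‖F y‖ₑ ^ 2
      = ∫⁻ x in O, ‖v x‖ₑ ^ 2 * ENNReal.ofReal |(Ψ' x).det|⁻¹ := by
    rw [setLIntegral_congr hcc]
    have e : (fun y => ‖F y‖ₑ ^ 2) = (Ψ '' O).indicator (fun y => ‖F₀ y‖ₑ ^ 2) := by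
      ext y
      by_cases hy : y ∈ Ψ '' O <;> simp [hFdef, hy]
    rw [e, setLIntegral_indicator him, Set.inter_eq_left.mpr hcube,
      lintegral_image_eq_lintegral_abs_det_fderiv_mul _ hO hd hinj]
    refine setLIntegral_congr_fun hO fun x hx => ?_
    simp only [hF₀v x hx, enorm_sq_ofReal]
    have := hpos x hx
    rw [← ENNReal.ofReal_mul (abs_nonneg _), ← ENNReal.ofReal_mul (by positivity)]
    congr 1
    rw [norm_mul, Complex.norm_real, norm_inv, Real.norm_eq_abs, abs_abs]
    field_simp
  rw [← hL] at hfin ⊢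
  rw [← parseval F hF hfin]
  refine tsum_congr fun k => ?_
  congr 2
  rw [setIntegral_congr_set hcc]
  have e : (fun y : Fin r → ℝ => Complex.exp (2 * Real.pi * Complex.I *
      ((∑ j, y j * (k j : ℝ) : ℝ) : ℂ)) * F y) = (Ψ '' O).indicator (fun y =>
      Complex.exp (2 * Real.pi * Complex.I * ((∑ j, y j * (k j : ℝ) : ℝ) : ℂ)) * F₀ y) := by
    ext y
    by_cases hy : y ∈ Ψ '' O <;> simp [hFdef, hy]
  rw [e, setIntegral_indicator him, Set.inter_eq_right.mpr hcube,
    integral_image_eq_integral_abs_det_fderiv_smul _ hO hd hinj]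
  refine setIntegral_congr_fun hO fun x hx => ?_
  simp only [hF₀v x hx, Complex.real_smul]
  have : ((|(Ψ' x).det| : ℝ) : ℂ) ≠ 0 := by exact_mod_cast (hpos x hx).ne'
  push_cast
  field_simp

end Stmt8

/-- (Sufficient condition for the frame property, Lemma 2.16 of the paper,
realized in coordinates for conormal group `H = ℝʳ`.)  Let `O ⊆ ℝʳ` be bounded open,
`Θ : O → ℝʳ` injective and `C¹` with everywhere nonvanishing Jacobian determinant and bounded
image, and `w = |det DΘ|⁻¹` on `O`.  Let `f` be continuous with compact support contained in
`O`, let `Λ ⊆ ℝʳ` be countable and `0 < m ≤ M < ∞` with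
`m ≤ ∑_{ℓ ∈ Λ} |f(ℓ+h)|² w(ℓ+h) ≤ M` for a.e. `h`.  Let `ς > 0` with `Θ(O) ⊆ [-ς, ς)ʳ` and
let `g_{ℓ,k}(h) = exp(2πi⟨Θ(ℓ+h), k⟩/(2ς)) f(ℓ+h)` (zero when `ℓ + h ∉ O`).  Then
`(g_{ℓ,k})` is a frame for `L²(ℝʳ)` with frame bounds `m(2ς)ʳ` and `M(2ς)ʳ`. -/
theorem stmt_8 (r : ℕ) (hr : 0 < r)
    (O : Set (Fin r → ℝ)) (hO_open : IsOpen O) (hO_bdd : Bornology.IsBounded O)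
    (Θ : (Fin r → ℝ) → (Fin r → ℝ)) (hΘ_inj : Set.InjOn Θ O)
    (hΘ_C1 : ContDiffOn ℝ 1 Θ O)
    (hΘ_det : ∀ h ∈ O, (fderivWithin ℝ Θ O h).det ≠ 0)
    (hΘO_bdd : Bornology.IsBounded (Θ '' O))
    (w : (Fin r → ℝ) → ℝ) (hw : ∀ h ∈ O, w h = |(fderivWithin ℝ Θ O h).det|⁻¹)
    (f : (Fin r → ℝ) → ℂ) (hf_cont : Continuous f) (hf_supp : HasCompactSupport f)
    (hf_suppO : tsupport f ⊆ O)
    (Λ : Set (Fin r → ℝ)) (hΛ : Λ.Countable)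
    (m M : ℝ) (hm : 0 < m) (hmM : m ≤ M)
    (hbounds : ∀ᵐ h ∂(volume : Measure (Fin r → ℝ)),
      Summable (fun ℓ : Λ => Set.indicator O (fun x => ‖f x‖ ^ 2 * w x) (↑ℓ + h)) ∧
      m ≤ ∑' ℓ : Λ, Set.indicator O (fun x => ‖f x‖ ^ 2 * w x) (↑ℓ + h) ∧
      (∑' ℓ : Λ, Set.indicator O (fun x => ‖f x‖ ^ 2 * w x) (↑ℓ + h)) ≤ M)
    (ς : ℝ) (hς : 0 < ς)
    (hΘς : Θ '' O ⊆ Set.univ.pi fun _ : Fin r => Set.Ico (-ς) ς)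
    (g : Λ × (Fin r → ℤ) → Lp ℂ 2 (volume : Measure (Fin r → ℝ)))
    (hg : ∀ p : Λ × (Fin r → ℤ), ⇑(g p) =ᵐ[(volume : Measure (Fin r → ℝ))]
      fun h : Fin r → ℝ => Set.indicator O
        (fun x => Complex.exp (2 * Real.pi * Complex.I *
            (↑(∑ j, Θ x j * ((p.2 j : ℤ) : ℝ)) : ℂ) / (↑(2 * ς) : ℂ)) * f x)
        (↑p.1 + h)) :
    ∀ u : Lp ℂ 2 (volume : Measure (Fin r → ℝ)),
      Summable (fun p : Λ × (Fin r → ℤ) => ‖@inner ℂ _ _ u (g p)‖ ^ 2) ∧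
      m * (2 * ς) ^ r * ‖u‖ ^ 2 ≤ ∑' p : Λ × (Fin r → ℤ), ‖@inner ℂ _ _ u (g p)‖ ^ 2 ∧
      (∑' p : Λ × (Fin r → ℤ), ‖@inner ℂ _ _ u (g p)‖ ^ 2) ≤ M * (2 * ς) ^ r * ‖u‖ ^ 2 := by
  classical
  have : Countable Λ := hΛ.to_subtype
  have hOm : MeasurableSet O := hO_open.measurableSet
  intro u
  have hum : Measurable u := (Lp.stronglyMeasurable u).measurable
  have h2ς : (0 : ℝ) < 2 * ς := by positivity
  set W : (Fin r → ℝ) → ℝ := Set.indicator O (fun x => ‖f x‖ ^ 2 * w x) with hW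
  have hdetc : ContinuousOn (fun x => (fderivWithin ℝ Θ O x).det) O :=
    ContinuousLinearMap.continuous_det.comp_continuousOn
      (hΘ_C1.continuousOn_fderivWithin hO_open.uniqueDiffOn le_rfl)
  have hW0 : ∀ x, 0 ≤ W x := by
    intro x
    refine Set.indicator_nonneg (fun x hx => ?_) x
    rw [hw x hx]; positivity
  have hWm : Measurable W := by
    have hc : ContinuousOn (fun x => ‖f x‖ ^ 2 * w x) O := by
      have hwc : ContinuousOn w O :=
        (hdetc.abs.inv₀ (fun x hx => abs_ne_zero.mpr (hΘ_det x hx))).congr hw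
      exact (hf_cont.norm.pow 2).continuousOn.mul hwc
    rw [hW, ← Set.piecewise_eq_indicator]
    exact hc.measurable_piecewise continuousOn_const hOm
  -- scaled map
  set c : ℝ := (2 * ς)⁻¹ with hc
  have hc0 : 0 < c := by positivity
  set Ψ : (Fin r → ℝ) → (Fin r → ℝ) := fun x => c • Θ x with hΨ
  set Ψ' : (Fin r → ℝ) → ((Fin r → ℝ) →L[ℝ] (Fin r → ℝ)) :=
    fun x => c • fderivWithin ℝ Θ O x with hΨ'
  have hΨdet : ∀ x, (Ψ' x).det = c ^ r * (fderivWithin ℝ Θ O x).det := by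
    intro x
    simp only [hΨ', ContinuousLinearMap.det, ContinuousLinearMap.toLinearMap_smul,
      LinearMap.det_smul, Module.finrank_fin_fun]
  have hd : ∀ x ∈ O, HasFDerivWithinAt Ψ (Ψ' x) O x := fun x hx =>
    ((hΘ_C1.differentiableOn one_ne_zero x hx).hasFDerivWithinAt).const_smul c
  have hinj : Set.InjOn Ψ O := by
    intro x hx y hy hxy
    exact hΘ_inj hx hy (smul_right_injective _ hc0.ne' hxy)
  have hdet : ∀ x ∈ O, (Ψ' x).det ≠ 0 := fun x hx => by
    rw [hΨdet]; exact mul_ne_zero (by positivity) (hΘ_det x hx)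
  have hcont : ContinuousOn (fun x => (Ψ' x).det) O := by
    simp only [hΨdet]; exact continuousOn_const.mul hdetc
  have hcube : Ψ '' O ⊆ Set.univ.pi fun _ => Set.Ico (-1/2 : ℝ) (1/2) := by
    rintro _ ⟨x, hx, rfl⟩ j -
    have h := hΘς ⟨x, hx, rfl⟩ j (Set.mem_univ j)
    simp only [hΨ, Pi.smul_apply, smul_eq_mul, hc, Set.mem_Ico] at h ⊢
    have e : (2 * ς)⁻¹ * Θ x j = Θ x j / (2 * ς) := by ring
    rw [e, le_div_iff₀ h2ς, div_lt_iff₀ h2ς]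
    constructor <;> linarith [h.1, h.2]
  set U : ENNReal := ∫⁻ h, ‖u h‖ₑ ^ 2 with hU
  have hUn : U = ENNReal.ofReal (‖u‖ ^ 2) := by
    have h1 := eLpNorm_nnreal_pow_eq_lintegral (f := u) (μ := volume) (p := 2) (by norm_num)
    simp only [NNReal.coe_ofNat, ENNReal.coe_ofNat, ENNReal.rpow_ofNat] at h1
    rw [hU, ← h1, ← Lp.enorm_def, ENNReal.ofReal_pow (norm_nonneg _), ofReal_norm]
  -- inner sums
  set R : Λ → ENNReal := fun ℓ => ∫⁻ h, ‖u h‖ₑ ^ 2 * ENNReal.ofReal (W (↑ℓ + h)) with hR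
  have hRfin : ∀ ℓ, R ℓ ≠ ⊤ := by
    intro ℓ
    have : R ℓ ≤ ∫⁻ h, ‖u h‖ₑ ^ 2 * ENNReal.ofReal M := by
      refine lintegral_mono_ae ?_
      filter_upwards [hbounds] with h hh
      gcongr
      exact (hh.1.le_tsum ℓ (fun j _ => hW0 _)).trans hh.2.2
    refine ne_top_of_le_ne_top ?_ this
    rw [lintegral_mul_const _ (by fun_prop), ← hU, hUn]
    exact ENNReal.mul_ne_top ENNReal.ofReal_ne_top ENNReal.ofReal_ne_top
  have hinner : ∀ ℓ : Λ, ∑' k : Fin r → ℤ, ‖@inner ℂ _ _ u (g (ℓ, k))‖ₑ ^ 2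
      = ENNReal.ofReal ((2 * ς) ^ r) * R ℓ := by
    intro ℓ
    set v : (Fin r → ℝ) → ℂ := fun x => f x * (starRingEnd ℂ) (u (-(ℓ : Fin r → ℝ) + x)) with hv
    have hvm : Measurable v := by
      refine hf_cont.measurable.mul (Complex.continuous_conj.measurable.comp (hum.comp ?_))
      exact measurable_const_add _
    have hT : ∫⁻ x in O, ‖v x‖ₑ ^ 2 * ENNReal.ofReal |(Ψ' x).det|⁻¹
        = ENNReal.ofReal ((2 * ς) ^ r) * R ℓ := by
      have e1 : R ℓ = ∫⁻ x, ‖u (-(ℓ : Fin r → ℝ) + x)‖ₑ ^ 2 * ENNReal.ofReal (W x) := by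
        rw [← lintegral_add_left_eq_self _ (ℓ : Fin r → ℝ)]
        simp [hR]
      rw [e1, ← lintegral_const_mul _ (by fun_prop), ← lintegral_indicator hOm]
      refine lintegral_congr fun x => ?_
      by_cases hx : x ∈ O
      · simp only [Set.indicator_of_mem hx, hW, Stmt8.enorm_sq_ofReal, hw x hx, hΨdet, hv]
        rw [← ENNReal.ofReal_mul (by positivity), ← ENNReal.ofReal_mul (by positivity),
          ← ENNReal.ofReal_mul (by positivity)]
        congr 1
        rw [abs_mul, abs_of_pos (pow_pos hc0 r), norm_mul, RCLike.norm_conj, hc, inv_pow, mul_inv,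
          inv_inv]
        ring
      · simp [hx, hW]
    rw [← hT, ← Stmt8.parseval_image hOm hd hinj hdet hcont hcube v hvm
      (by rw [hT]; exact ENNReal.mul_ne_top ENNReal.ofReal_ne_top (hRfin ℓ))]
    refine tsum_congr fun k => ?_
    congr 2
    rw [L2.inner_def, ← integral_indicator hOm,
      ← integral_add_left_eq_self (Set.indicator O _) (ℓ : Fin r → ℝ)]
    refine integral_congr_ae ?_
    filter_upwards [hg (ℓ, k)] with h hh
    rw [hh]
    by_cases hx : (ℓ : Fin r → ℝ) + h ∈ O
    · simp only [Set.indicator_of_mem hx, RCLike.inner_apply, hv, neg_add_cancel_left]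
      rw [← mul_assoc]
      congr 3
      simp only [hΨ, Pi.smul_apply, smul_eq_mul, hc]
      push_cast
      simp only [mul_assoc, ← Finset.mul_sum]
      ring
    · simp [hx]
  have hS : ∑' p : Λ × (Fin r → ℤ), ENNReal.ofReal (‖@inner ℂ _ _ u (g p)‖ ^ 2)
      = ENNReal.ofReal ((2 * ς) ^ r) *
        ∫⁻ h, ‖u h‖ₑ ^ 2 * ∑' ℓ : Λ, ENNReal.ofReal (W (↑ℓ + h)) := by
    simp only [← Stmt8.enorm_sq_ofReal]
    rw [ENNReal.tsum_prod']
    simp only [hinner]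
    rw [ENNReal.tsum_mul_left]
    congr 1
    simp only [hR]
    rw [← lintegral_tsum (fun ℓ => by fun_prop)]
    simp only [ENNReal.tsum_mul_left]
  have hmid : ∀ᵐ h : Fin r → ℝ, ENNReal.ofReal m ≤ ∑' ℓ : Λ, ENNReal.ofReal (W (↑ℓ + h)) ∧
      ∑' ℓ : Λ, ENNReal.ofReal (W (↑ℓ + h)) ≤ ENNReal.ofReal M := by
    filter_upwards [hbounds] with h hh
    rw [← ENNReal.ofReal_tsum_of_nonneg (fun _ => hW0 _) hh.1]
    exact ⟨ENNReal.ofReal_le_ofReal hh.2.1, ENNReal.ofReal_le_ofReal hh.2.2⟩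
  have hM0 : 0 < M := hm.trans_le hmM
  have key : ∀ a : ℝ, 0 ≤ a → ENNReal.ofReal ((2 * ς) ^ r) * ∫⁻ h, ‖u h‖ₑ ^ 2 * ENNReal.ofReal a
      = ENNReal.ofReal (a * (2 * ς) ^ r * ‖u‖ ^ 2) := by
    intro a ha
    rw [lintegral_mul_const _ (by fun_prop), ← hU, hUn, ← ENNReal.ofReal_mul (by positivity),
      ← ENNReal.ofReal_mul (by positivity)]
    congr 1
    ring
  have hlow : ENNReal.ofReal (m * (2 * ς) ^ r * ‖u‖ ^ 2) ≤
      ∑' p : Λ × (Fin r → ℤ), ENNReal.ofReal (‖@inner ℂ _ _ u (g p)‖ ^ 2) := by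
    rw [hS, ← key m hm.le]
    refine mul_le_mul_right ?_ _
    refine lintegral_mono_ae ?_
    filter_upwards [hmid] with h hh
    gcongr
    exact hh.1
  have hupp : ∑' p : Λ × (Fin r → ℤ), ENNReal.ofReal (‖@inner ℂ _ _ u (g p)‖ ^ 2) ≤
      ENNReal.ofReal (M * (2 * ς) ^ r * ‖u‖ ^ 2) := by
    rw [hS, ← key M hM0.le]
    refine mul_le_mul_right ?_ _
    refine lintegral_mono_ae ?_
    filter_upwards [hmid] with h hh
    gcongr
    exact hh.2
  have hsum : Summable (fun p : Λ × (Fin r → ℤ) => ‖@inner ℂ _ _ u (g p)‖ ^ 2) := by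
    have := ENNReal.summable_toReal (ne_top_of_le_ne_top ENNReal.ofReal_ne_top hupp)
    refine this.congr fun p => ?_
    rw [ENNReal.toReal_ofReal (by positivity)]
  rw [← ENNReal.ofReal_tsum_of_nonneg (fun _ => by positivity) hsum] at hlow hupp
  refine ⟨hsum, ?_, ?_⟩
  · exact (ENNReal.ofReal_le_ofReal_iff (tsum_nonneg fun _ => by positivity)).mp hlow
  · exact (ENNReal.ofReal_le_ofReal_iff (by positivity)).mp hupp
end

section
/- Let r ≥ 1, let O ⊆ ℝʳ be a bounded open set, and let Θ : O → ℝʳ be an injective C¹ map with det DΘ(h) ≠ 0 for every h ∈ O and with Θ(O) bounded. Set w(h) = |det DΘ(h)|⁻¹ for h ∈ O. Let f : ℝʳ → ℂ be continuous with compact support contained in O, let Λ ⊆ ℝʳ be a countable set, and let ς > 0 satisfy Θ(O) ⊆ [-ς, ς)ʳ. For (ℓ, k) ∈ Λ × ℤʳ define g_{ℓ,k} ∈ L²(ℝʳ) by g_{ℓ,k}(h) = exp( 2πi ⟨Θ(ℓ + h), k⟩ / (2ς) ) · f(ℓ + h) when ℓ + h ∈ O and g_{ℓ,k}(h) = 0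 otherwise. If the family (g_{ℓ,k})_{(ℓ,k) ∈ Λ × ℤʳ} is a frame for L²(ℝʳ) with frame bounds A ≤ B, then for almost every h ∈ ℝʳ one has A·(2ς)^{-r} ≤ ∑_{ℓ ∈ Λ} |f(ℓ + h)|² w(ℓ + h) ≤ B·(2ς)^{-r}. In particular f is (essentially) bounded. -/
open MeasureTheory


section torus
noncomputable local instance auxMS : MeasureSpace UnitAddCircle := ⟨AddCircle.haarAddCircle⟩
local instance auxHaar : Measure.IsAddHaarMeasure (volume : Measure UnitAddCircle) :=
  inferInstanceAs (Measure.IsAddHaarMeasure AddCircle.haarAddCircle)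
local instance auxProb : IsProbabilityMeasure (volume : Measure UnitAddCircle) :=
  inferInstanceAs (IsProbabilityMeasure AddCircle.haarAddCircle)

theorem aux_parseval (r : ℕ) (G : (Fin r → ℝ) → ℂ) (hG : Measurable G) (C : ℝ)
    (hC : ∀ y, ‖G y‖ ≤ C) :
    HasSum (fun n : Fin r → ℤ => ‖∫ y in Set.univ.pi fun _ : Fin r => Set.Ico (-(1/2) : ℝ) (1/2),
      Complex.exp (2 * Real.pi * Complex.I * (↑(∑ j, y j * ((n j : ℤ) : ℝ)) : ℂ)) * G y‖ ^ 2)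
      (∫ y in Set.univ.pi fun _ : Fin r => Set.Ico (-(1/2) : ℝ) (1/2), ‖G y‖ ^ 2) := by
  let s : UnitAddTorus (Fin r) → (Fin r → ℝ) :=
    fun t i => (AddCircle.measurableEquivIco 1 (-(1/2) : ℝ) (t i) : ℝ)
  have hs : Measurable s := by
    refine measurable_pi_lambda _ fun i => ?_
    exact measurable_subtype_coe.comp
      ((AddCircle.measurableEquivIco 1 (-(1/2) : ℝ)).measurable.comp (measurable_pi_apply i))
  have hF : MemLp (fun t => G (s t)) 2 (volume : Measure (UnitAddTorus (Fin r))) :=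
    MemLp.of_bound (hG.comp hs).aestronglyMeasurable C (Filter.Eventually.of_forall fun t => hC _)
  have key := UnitAddTorus.hasSum_sq_mFourierCoeff (hF.toLp _)
  have hset : ({x : Fin r → ℝ | ∀ i, x i ∈ Set.Ioc ((fun _ => -(1/2) : Fin r → ℝ) i) ((fun _ => -(1/2) : Fin r → ℝ) i + 1)} : Set (Fin r → ℝ))
      =ᵐ[volume] (Set.univ.pi fun _ : Fin r => Set.Ico (-(1/2) : ℝ) (1/2)) := by
    have e : ({x : Fin r → ℝ | ∀ i, x i ∈ Set.Ioc ((fun _ => -(1/2) : Fin r → ℝ) i) ((fun _ => -(1/2) : Fin r → ℝ) i + 1)} : Set (Fin r → ℝ)) = Set.univ.pi fun _ : Fin r => Set.Ioc (-(1/2) : ℝ) (1/2) := by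
      ext x; simp only [Set.mem_ofPred_eq, Set.mem_pi, Set.mem_univ, true_imp_iff]; norm_num
    rw [e]
    exact (Measure.univ_pi_Ioc_ae_eq_Icc).trans (Measure.univ_pi_Ico_ae_eq_Icc).symm
  have hms : MeasurableSet (Set.univ.pi fun _ : Fin r => Set.Ico (-(1/2) : ℝ) (1/2)) :=
    MeasurableSet.univ_pi fun _ => measurableSet_Ico
  have hsx : ∀ x ∈ (Set.univ.pi fun _ : Fin r => Set.Ico (-(1/2) : ℝ) (1/2)),
      s (fun i => (x i : UnitAddCircle)) = x := by
    intro x hx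
    funext i
    have hx' : x i ∈ Set.Ico (-(1/2) : ℝ) (-(1/2) + 1) := by
      have := hx i trivial
      norm_num at this ⊢; exact this
    exact congrArg Subtype.val (AddCircle.equivIco_coe_eq hx')
  have h2 : (∫ t, ‖(hF.toLp _ : UnitAddTorus (Fin r) → ℂ) t‖ ^ 2)
      = ∫ y in Set.univ.pi fun _ : Fin r => Set.Ico (-(1/2) : ℝ) (1/2), ‖G y‖ ^ 2 := by
    have : (∫ t, ‖(hF.toLp _ : UnitAddTorus (Fin r) → ℂ) t‖ ^ 2) = ∫ t, ‖G (s t)‖ ^ 2 := by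
      refine integral_congr_ae ?_
      filter_upwards [hF.coeFn_toLp] with t ht
      rw [ht]
    rw [this, UnitAddTorus.integral_preimage _ (fun _ => -(1/2)), setIntegral_congr_set hset]
    refine setIntegral_congr_fun hms fun x hx => ?_
    simp only [hsx x hx]
  have h1 : ∀ n, UnitAddTorus.mFourierCoeff (hF.toLp _ : UnitAddTorus (Fin r) → ℂ) (-n)
      = ∫ y in Set.univ.pi fun _ : Fin r => Set.Ico (-(1/2) : ℝ) (1/2),
      Complex.exp (2 * Real.pi * Complex.I * (↑(∑ j, y j * ((n j : ℤ) : ℝ)) : ℂ)) * G y := by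
    intro n
    have : UnitAddTorus.mFourierCoeff (hF.toLp _ : UnitAddTorus (Fin r) → ℂ) (-n)
        = UnitAddTorus.mFourierCoeff (fun t => G (s t)) (-n) := by
      refine integral_congr_ae ?_
      filter_upwards [hF.coeFn_toLp] with t ht
      rw [ht]
    rw [this, UnitAddTorus.mFourierCoeff_eq_integral _ _ (fun _ => -(1/2)), setIntegral_congr_set hset]
    refine setIntegral_congr_fun hms fun x hx => ?_
    simp only [hsx x hx, smul_eq_mul, neg_neg]
    congr 1
    simp only [UnitAddTorus.mFourier, ContinuousMap.coe_mk, fourier_coe_apply]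
    rw [← Complex.exp_sum]
    congr 1
    push_cast
    rw [Finset.mul_sum]
    refine Finset.sum_congr rfl fun i _ => ?_
    ring
  rw [h2] at key
  have := (Equiv.neg (Fin r → ℤ)).hasSum_iff.mpr key
  refine this.congr_fun ?_
  intro n
  simp only [Function.comp, Equiv.neg_apply, h1]
end torus

theorem aux_cov (r : ℕ) (O : Set (Fin r → ℝ)) (hO : MeasurableSet O)
    (Ψ : (Fin r → ℝ) → (Fin r → ℝ)) (Ψ' : (Fin r → ℝ) → (Fin r → ℝ) →L[ℝ] (Fin r → ℝ))
    (hΨ' : ∀ x ∈ O, HasFDerivWithinAt Ψ (Ψ' x) O x) (hinj : Set.InjOn Ψ O)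
    (him : Ψ '' O ⊆ Set.univ.pi fun _ : Fin r => Set.Ico (-(1/2) : ℝ) (1/2))
    (φ : (Fin r → ℝ) → ℂ) (hφ : Measurable φ) (C : ℝ) (hC : ∀ x, ‖φ x‖ ≤ C) :
    HasSum (fun n : Fin r → ℤ => ‖∫ x in O, |(Ψ' x).det| •
      (Complex.exp (2 * Real.pi * Complex.I * (↑(∑ j, Ψ x j * ((n j : ℤ) : ℝ)) : ℂ)) * φ x)‖ ^ 2)
      (∫ x in O, |(Ψ' x).det| • ‖φ x‖ ^ 2) := by
  have emb := measurableEmbedding_of_fderivWithin hO hΨ' hinj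
  let G : (Fin r → ℝ) → ℂ := Function.extend (O.domRestrict Ψ) (fun x => φ x) 0
  have hG : Measurable G := emb.measurable_extend (hφ.comp measurable_subtype_coe) measurable_zero
  have hGx : ∀ x ∈ O, G (Ψ x) = φ x := fun x hx =>
    emb.injective.extend_apply (fun x : O => φ x) 0 ⟨x, hx⟩
  have hG0 : ∀ y, y ∉ Ψ '' O → G y = 0 := by
    intro y hy
    refine Function.extend_apply' _ _ _ ?_
    rintro ⟨⟨x, hx⟩, rfl⟩
    exact hy ⟨x, hx, rfl⟩
  have hGC : ∀ y, ‖G y‖ ≤ C := by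
    intro y
    by_cases hy : y ∈ Ψ '' O
    · obtain ⟨x, hx, rfl⟩ := hy
      rw [hGx x hx]; exact hC x
    · rw [hG0 y hy, norm_zero]; exact (norm_nonneg _).trans (hC 0)
  have key := aux_parseval r G hG C hGC
  have hsub : ∀ {E : Type} [NormedAddCommGroup E] [NormedSpace ℝ E] (H : (Fin r → ℝ) → E)
      (_ : ∀ y, y ∉ Ψ '' O → H y = 0),
      ∫ y in Set.univ.pi fun _ : Fin r => Set.Ico (-(1/2) : ℝ) (1/2), H y
        = ∫ x in O, |(Ψ' x).det| • H (Ψ x) := by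
    intro E _ _ H hH
    rw [← integral_image_eq_integral_abs_det_fderiv_smul volume hO hΨ' hinj,
      setIntegral_eq_integral_of_forall_compl_eq_zero hH]
    exact setIntegral_eq_integral_of_forall_compl_eq_zero fun y hy => hH y fun h => hy (him h)
  rw [hsub _ (fun y hy => by simp [hG0 y hy])] at key
  have e2 : (∫ x in O, |(Ψ' x).det| • ‖G (Ψ x)‖ ^ 2) = ∫ x in O, |(Ψ' x).det| • ‖φ x‖ ^ 2 :=
    setIntegral_congr_fun hO fun x hx => by simp only [hGx x hx]
  rw [e2] at key
  refine key.congr_fun fun n => ?_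
  rw [hsub _ (fun y hy => by simp [hG0 y hy])]
  congr 2
  exact setIntegral_congr_fun hO fun x hx => by simp only [hGx x hx]

/-- Integral over a translated window. -/
theorem aux_shift (r : ℕ) (ℓ : Fin r → ℝ) (E : Set (Fin r → ℝ)) (hE : MeasurableSet E)
    (H : (Fin r → ℝ) → ℂ) :
    ∫ h in E, H (ℓ + h) = ∫ x, Set.indicator ((fun x => x - ℓ) ⁻¹' E) H x := by
  rw [← integral_indicator hE, ← integral_add_left_eq_self (Set.indicator ((fun x => x - ℓ) ⁻¹' E) H) ℓ]
  refine integral_congr_ae (Filter.Eventually.of_forall fun h => ?_)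
  have e : (ℓ + h ∈ (fun x : Fin r → ℝ => x - ℓ) ⁻¹' E) ↔ h ∈ E := by
    rw [Set.mem_preimage, add_sub_cancel_left]
  beta_reduce
  by_cases hh : h ∈ E
  · rw [Set.indicator_of_mem hh, Set.indicator_of_mem (e.mpr hh)]
  · rw [Set.indicator_of_notMem hh, Set.indicator_of_notMem (fun h' => hh (e.mp h'))]

theorem aux_lshift (r : ℕ) (ℓ : Fin r → ℝ) (E : Set (Fin r → ℝ)) (hE : MeasurableSet E)
    (H : (Fin r → ℝ) → ENNReal) :
    ∫⁻ h in E, H (ℓ + h) = ∫⁻ x, Set.indicator ((fun x => x - ℓ) ⁻¹' E) H x := by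
  rw [← lintegral_indicator hE, ← lintegral_add_left_eq_self (Set.indicator ((fun x => x - ℓ) ⁻¹' E) H) ℓ]
  refine lintegral_congr fun h => ?_
  have e : (ℓ + h ∈ (fun x : Fin r → ℝ => x - ℓ) ⁻¹' E) ↔ h ∈ E := by
    rw [Set.mem_preimage, add_sub_cancel_left]
  by_cases hh : h ∈ E
  · rw [Set.indicator_of_mem hh, Set.indicator_of_mem (e.mpr hh)]
  · rw [Set.indicator_of_notMem hh, Set.indicator_of_notMem (fun h' => hh (e.mp h'))]

theorem aux_tsum_prod {α β : Type*} (a : α × β → ENNReal) :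
    ∑' p, a p = ∑' x, ∑' y, a (x, y) :=
  ENNReal.tsum_prod (f := fun x y => a (x, y))

/-- (Necessity of the covering bounds; the proposition following Lemma 2.16
of the paper, realized in coordinates for conormal group `H = ℝʳ`.)  With `O`, `Θ`, `w`, `f`,
`Λ`, `ς` and `g_{ℓ,k}` as in Statement 8, if `(g_{ℓ,k})_{(ℓ,k) ∈ Λ × ℤʳ}` is a frame for
`L²(ℝʳ)` with frame bounds `A ≤ B`, then for almost every `h`,
`A (2ς)^{-r} ≤ ∑_{ℓ ∈ Λ} |f(ℓ+h)|² w(ℓ+h) ≤ B (2ς)^{-r}`.  In particular `f` is bounded. -/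
theorem stmt_9 (r : ℕ) (hr : 0 < r)
    (O : Set (Fin r → ℝ)) (hO_open : IsOpen O) (hO_bdd : Bornology.IsBounded O)
    (Θ : (Fin r → ℝ) → (Fin r → ℝ)) (hΘ_inj : Set.InjOn Θ O)
    (hΘ_C1 : ContDiffOn ℝ 1 Θ O)
    (hΘ_det : ∀ h ∈ O, (fderivWithin ℝ Θ O h).det ≠ 0)
    (hΘO_bdd : Bornology.IsBounded (Θ '' O))
    (w : (Fin r → ℝ) → ℝ) (hw : ∀ h ∈ O, w h = |(fderivWithin ℝ Θ O h).det|⁻¹)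
    (f : (Fin r → ℝ) → ℂ) (hf_cont : Continuous f) (hf_supp : HasCompactSupport f)
    (hf_suppO : tsupport f ⊆ O)
    (Λ : Set (Fin r → ℝ)) (hΛ : Λ.Countable)
    (ς : ℝ) (hς : 0 < ς)
    (hΘς : Θ '' O ⊆ Set.univ.pi fun _ : Fin r => Set.Ico (-ς) ς)
    (g : Λ × (Fin r → ℤ) → Lp ℂ 2 (volume : Measure (Fin r → ℝ)))
    (hg : ∀ p : Λ × (Fin r → ℤ), ⇑(g p) =ᵐ[(volume : Measure (Fin r → ℝ))]
      fun h : Fin r → ℝ => Set.indicator O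
        (fun x => Complex.exp (2 * Real.pi * Complex.I *
            (↑(∑ j, Θ x j * ((p.2 j : ℤ) : ℝ)) : ℂ) / (↑(2 * ς) : ℂ)) * f x)
        (↑p.1 + h))
    (A B : ℝ) (hA : 0 < A) (hAB : A ≤ B)
    (hframe : ∀ u : Lp ℂ 2 (volume : Measure (Fin r → ℝ)),
      Summable (fun p : Λ × (Fin r → ℤ) => ‖@inner ℂ _ _ u (g p)‖ ^ 2) ∧
      A * ‖u‖ ^ 2 ≤ ∑' p : Λ × (Fin r → ℤ), ‖@inner ℂ _ _ u (g p)‖ ^ 2 ∧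
      (∑' p : Λ × (Fin r → ℤ), ‖@inner ℂ _ _ u (g p)‖ ^ 2) ≤ B * ‖u‖ ^ 2) :
    (∀ᵐ h ∂(volume : Measure (Fin r → ℝ)),
      A * ((2 * ς) ^ r)⁻¹ ≤ ∑' ℓ : Λ, Set.indicator O (fun x => ‖f x‖ ^ 2 * w x) (↑ℓ + h) ∧
      (∑' ℓ : Λ, Set.indicator O (fun x => ‖f x‖ ^ 2 * w x) (↑ℓ + h)) ≤
        B * ((2 * ς) ^ r)⁻¹) ∧
    ∃ C : ℝ, ∀ x : Fin r → ℝ, ‖f x‖ ≤ C := by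
  obtain ⟨Cf, hCf⟩ := hf_supp.exists_bound_of_continuous hf_cont
  refine ⟨?_, Cf, hCf⟩
  have h2ς : 0 < 2 * ς := by positivity
  set c : ℝ := (2 * ς) ^ r with hc
  have hc0 : 0 < c := by positivity
  have hOm : MeasurableSet O := hO_open.measurableSet
  -- continuity of the weight
  have hdetc : ContinuousOn (fun x => (fderivWithin ℝ Θ O x).det) O :=
    ContinuousLinearMap.continuous_det.comp_continuousOn
      (hΘ_C1.continuousOn_fderivWithin hO_open.uniqueDiffOn le_rfl)
  have hwc : ContinuousOn w O := by
    refine ContinuousOn.congr (hdetc.abs.inv₀ fun x hx => ?_) hw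
    exact abs_ne_zero.mpr (hΘ_det x hx)
  have hw0 : ∀ x ∈ O, 0 ≤ w x := fun x hx => by rw [hw x hx]; positivity
  have hfO : ∀ x, x ∉ O → f x = 0 := fun x hx =>
    image_eq_zero_of_notMem_tsupport fun h => hx (hf_suppO h)
  -- the weighted window
  let F : (Fin r → ℝ) → ℂ := O.indicator (fun x => ((c * w x : ℝ) : ℂ) * f x)
  have hFx : ∀ x ∈ O, F x = ((c * w x : ℝ) : ℂ) * f x := fun x hx => Set.indicator_of_mem hx _
  have hFsupp : tsupport F ⊆ tsupport f := by
    refine closure_mono fun x hx hfx => hx ?_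
    simp only [F, Set.indicator, hfx, mul_zero, ite_self]
  have hFcont : Continuous F := by
    refine continuous_of_tsupport fun x hx => ?_
    have hxO : O ∈ nhds x := hO_open.mem_nhds (hf_suppO (hFsupp hx))
    have h1 : ContinuousAt (fun x => ((c * w x : ℝ) : ℂ) * f x) x :=
      (Complex.continuous_ofReal.continuousAt.comp
        (continuousAt_const.mul (hwc.continuousAt hxO))).mul hf_cont.continuousAt
    refine h1.congr ?_
    filter_upwards [hxO] with y hy
    exact (hFx y hy).symm
  have hFcomp : HasCompactSupport F := hf_supp.of_isClosed_subset (isClosed_tsupport F) hFsupp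
  obtain ⟨C, hC⟩ := hFcomp.exists_bound_of_continuous hFcont
  let q : (Fin r → ℝ) → ℝ := fun x => ‖f x‖ * ‖F x‖
  have hqc : Continuous q := hf_cont.norm.mul hFcont.norm
  have hqint : Integrable q volume :=
    hqc.integrable_of_hasCompactSupport (hf_supp.norm.mul_right)
  have hq0 : ∀ x, 0 ≤ q x := fun x => by positivity
  have hq : ∀ x, q x = c * Set.indicator O (fun x => ‖f x‖ ^ 2 * w x) x := by
    intro x
    by_cases hx : x ∈ O
    · simp only [q, hFx x hx, Set.indicator_of_mem hx, norm_mul, Complex.norm_real, Real.norm_eq_abs,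
        abs_of_pos hc0, abs_of_nonneg (hw0 x hx)]
      ring
    · simp [q, hfO x hx, hx]
  -- the normalized map
  let Ψ : (Fin r → ℝ) → (Fin r → ℝ) := fun x => (2 * ς)⁻¹ • Θ x
  let Ψ' : (Fin r → ℝ) → (Fin r → ℝ) →L[ℝ] (Fin r → ℝ) :=
    fun x => (2 * ς)⁻¹ • fderivWithin ℝ Θ O x
  have hΨ' : ∀ x ∈ O, HasFDerivWithinAt Ψ (Ψ' x) O x := fun x hx =>
    ((hΘ_C1.differentiableOn one_ne_zero) x hx).hasFDerivWithinAt.const_smul (2 * ς)⁻¹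
  have hΨinj : Set.InjOn Ψ O := fun x hx y hy hxy =>
    hΘ_inj hx hy (smul_right_injective _ (inv_ne_zero h2ς.ne') hxy)
  have hΨim : Ψ '' O ⊆ Set.univ.pi fun _ : Fin r => Set.Ico (-(1/2) : ℝ) (1/2) := by
    rintro _ ⟨x, hx, rfl⟩ j -
    have := hΘς ⟨x, hx, rfl⟩ j trivial
    simp only [Ψ, Pi.smul_apply, smul_eq_mul, Set.mem_Ico] at this ⊢
    rw [inv_mul_eq_div, le_div_iff₀ h2ς, div_lt_iff₀ h2ς]
    constructor <;> linarith [this.1, this.2]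
  have hdet : ∀ x, |(Ψ' x).det| = c⁻¹ * |(fderivWithin ℝ Θ O x).det| := by
    intro x
    have : (Ψ' x).det = ((2 * ς)⁻¹) ^ r * (fderivWithin ℝ Θ O x).det := by
      simp only [Ψ', ContinuousLinearMap.det, ContinuousLinearMap.toLinearMap_smul,
        LinearMap.det_smul, Module.finrank_fin_fun]
    rw [this, abs_mul, hc, ← inv_pow, abs_of_pos (by positivity)]
  have hdetw : ∀ x ∈ O, |(Ψ' x).det| * (c * w x) = 1 := by
    intro x hx
    have := abs_ne_zero.mpr (hΘ_det x hx)
    rw [hdet, hw x hx]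
    field_simp
  have hdF : ∀ x ∈ O, |(Ψ' x).det| • F x = f x := by
    intro x hx
    rw [hFx x hx, Complex.real_smul, ← mul_assoc, ← Complex.ofReal_mul, hdetw x hx]
    simp
  have hdq : ∀ x ∈ O, |(Ψ' x).det| • ‖F x‖ ^ 2 = q x := by
    intro x hx
    simp only [q]
    rw [← hdF x hx, norm_smul, Real.norm_eq_abs, abs_abs, smul_eq_mul]
    ring
  have hqO : ∀ x, x ∉ O → q x = 0 := fun x hx => by simp [q, hfO x hx]
  -- sum over k for one ℓ
  have hone : ∀ (E : Set (Fin r → ℝ)) (hE : MeasurableSet E) (hEf : volume E ≠ ⊤) (ℓ : Λ),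
      ∑' k : Fin r → ℤ, ENNReal.ofReal
        (‖@inner ℂ _ _ (indicatorConstLp 2 hE hEf (1 : ℂ)) (g (ℓ, k))‖ ^ 2) =
      ∫⁻ h in E, ENNReal.ofReal (q (↑ℓ + h)) := by
    intro E hE hEf ℓ
    have hE' : MeasurableSet ((fun x : Fin r → ℝ => x - (ℓ : Fin r → ℝ)) ⁻¹' E) :=
      (measurable_id.sub_const _) hE
    let φ : (Fin r → ℝ) → ℂ := Set.indicator ((fun x => x - (ℓ : Fin r → ℝ)) ⁻¹' E) F
    have hφm : Measurable φ := hFcont.measurable.indicator hE'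
    have hφC : ∀ x, ‖φ x‖ ≤ C := fun x => (norm_indicator_le_norm_self _ _).trans (hC x)
    have key := aux_cov r O hOm Ψ Ψ' hΨ' hΨinj hΨim φ hφm C hφC
    have hin : ∀ k : Fin r → ℤ, @inner ℂ _ _ (indicatorConstLp 2 hE hEf (1 : ℂ)) (g (ℓ, k)) =
        ∫ x in O, |(Ψ' x).det| • (Complex.exp (2 * Real.pi * Complex.I *
          (↑(∑ j, Ψ x j * ((k j : ℤ) : ℝ)) : ℂ)) * φ x) := by
      intro k
      rw [L2.inner_indicatorConstLp_one, setIntegral_congr_ae (g := fun h : Fin r → ℝ => Set.indicator O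
        (fun x => Complex.exp (2 * Real.pi * Complex.I *
            (↑(∑ j, Θ x j * ((k j : ℤ) : ℝ)) : ℂ) / (↑(2 * ς) : ℂ)) * f x)
        (↑ℓ + h)) hE ((hg (ℓ, k)).mono fun x hx _ => hx),
        aux_shift r ℓ E hE, ← integral_indicator hOm]
      refine integral_congr_ae (Filter.Eventually.of_forall fun x => ?_)
      by_cases hx : x ∈ O
      · by_cases hxE : x ∈ (fun x : Fin r → ℝ => x - (ℓ : Fin r → ℝ)) ⁻¹' E
        · simp only [φ, Set.indicator_of_mem hx, Set.indicator_of_mem hxE]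
          rw [← mul_smul_comm, hdF x hx]
          congr 2
          simp only [Ψ, Pi.smul_apply, smul_eq_mul, mul_assoc, ← Finset.mul_sum]
          push_cast
          field_simp
        · simp only [φ, Set.indicator_of_mem hx, Set.indicator_of_notMem hxE, mul_zero, smul_zero]
      · simp only [Set.indicator_of_notMem hx]
        simp [Set.indicator, hx]
    have hpt : ∀ x ∈ O, |(Ψ' x).det| • ‖φ x‖ ^ 2 =
        Set.indicator ((fun x => x - (ℓ : Fin r → ℝ)) ⁻¹' E) q x := by
      intro x hx
      by_cases hxE : x ∈ (fun x : Fin r → ℝ => x - (ℓ : Fin r → ℝ)) ⁻¹' E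
      · simp only [φ, Set.indicator_of_mem hxE, hdq x hx]
      · simp [φ, Set.indicator_of_notMem hxE]
    have hval : ∫ x in O, |(Ψ' x).det| • ‖φ x‖ ^ 2 =
        ∫ x, Set.indicator ((fun x => x - (ℓ : Fin r → ℝ)) ⁻¹' E) q x := by
      rw [setIntegral_congr_fun hOm hpt]
      refine setIntegral_eq_integral_of_forall_compl_eq_zero fun x hx => ?_
      simp [Set.indicator, hqO x hx]
    rw [hval] at key
    simp only [hin]
    rw [← ENNReal.ofReal_tsum_of_nonneg (fun _ => by positivity) key.summable, key.tsum_eq,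
      ofReal_integral_eq_lintegral_ofReal (hqint.indicator hE')
        (Filter.Eventually.of_forall fun x => Set.indicator_nonneg (fun x _ => hq0 x) x),
      aux_lshift r ℓ E hE (fun x => ENNReal.ofReal (q x))]
    refine lintegral_congr fun x => ?_
    by_cases hxE : x ∈ (fun x : Fin r → ℝ => x - (ℓ : Fin r → ℝ)) ⁻¹' E
    · simp only [Set.indicator_of_mem hxE]
    · simp [Set.indicator_of_notMem hxE]
  have : Countable Λ := hΛ.to_subtype
  let Q : (Fin r → ℝ) → ENNReal := fun h => ∑' ℓ : Λ, ENNReal.ofReal (q (↑ℓ + h))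
  have hqm : ∀ ℓ : Λ, Measurable fun h : Fin r → ℝ => ENNReal.ofReal (q (↑ℓ + h)) := fun ℓ =>
    (hqc.measurable.comp (measurable_const_add _)).ennreal_ofReal
  have hQm : Measurable Q := Measurable.tsum hqm
  have hmain : ∀ (E : Set (Fin r → ℝ)), MeasurableSet E → volume E < ⊤ →
      ENNReal.ofReal A * volume E ≤ ∫⁻ h in E, Q h ∧
      ∫⁻ h in E, Q h ≤ ENNReal.ofReal B * volume E := by
    intro E hE hEf
    obtain ⟨hsum, hlo, hhi⟩ := hframe (indicatorConstLp 2 hE hEf.ne (1 : ℂ))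
    have hnorm : ‖indicatorConstLp 2 hE hEf.ne (1 : ℂ)‖ ^ 2 = volume.real E := by
      rw [norm_indicatorConstLp (by norm_num) (by norm_num), norm_one, one_mul,
        ← Real.rpow_natCast, ← Real.rpow_mul measureReal_nonneg]
      norm_num
    have hQE : ∫⁻ h in E, Q h = ENNReal.ofReal (∑' p : Λ × (Fin r → ℤ),
        ‖@inner ℂ _ _ (indicatorConstLp 2 hE hEf.ne (1 : ℂ)) (g p)‖ ^ 2) := by
      rw [ENNReal.ofReal_tsum_of_nonneg (fun _ => by positivity) hsum, aux_tsum_prod,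
        lintegral_tsum fun ℓ => (hqm ℓ).aemeasurable]
      exact (tsum_congr fun ℓ => hone E hE hEf.ne ℓ).symm
    have hvol : volume E = ENNReal.ofReal (volume.real E) :=
      (ENNReal.ofReal_toReal hEf.ne).symm
    rw [hnorm] at hlo hhi
    have hAv : ENNReal.ofReal A * volume E = ENNReal.ofReal (A * volume.real E) := by
      rw [ENNReal.ofReal_mul hA.le, ← hvol]
    have hBv : ENNReal.ofReal B * volume E = ENNReal.ofReal (B * volume.real E) := by
      rw [ENNReal.ofReal_mul (hA.le.trans hAB), ← hvol]
    rw [hQE, hAv, hBv]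
    exact ⟨ENNReal.ofReal_le_ofReal hlo, ENNReal.ofReal_le_ofReal hhi⟩
  have hlo : (fun _ => ENNReal.ofReal A) ≤ᵐ[volume] Q :=
    ae_le_of_forall_setLIntegral_le_of_sigmaFinite measurable_const fun E hE hEf => by
      rw [setLIntegral_const]; exact (hmain E hE hEf).1
  have hhi : Q ≤ᵐ[volume] (fun _ => ENNReal.ofReal B) :=
    ae_le_of_forall_setLIntegral_le_of_sigmaFinite hQm fun E hE hEf => by
      rw [setLIntegral_const]; exact (hmain E hE hEf).2
  filter_upwards [hlo, hhi] with h h1 h2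
  have hfin : Q h ≠ ⊤ := (h2.trans_lt ENNReal.ofReal_lt_top).ne
  have hreal : (Q h).toReal = c * ∑' ℓ : Λ, Set.indicator O (fun x => ‖f x‖ ^ 2 * w x) (↑ℓ + h) := by
    simp only [Q]
    rw [ENNReal.tsum_toReal_eq fun _ => ENNReal.ofReal_ne_top, ← tsum_mul_left]
    refine tsum_congr fun ℓ => ?_
    rw [ENNReal.toReal_ofReal (hq0 _), hq]
  have h1' : A ≤ (Q h).toReal := (ENNReal.ofReal_le_iff_le_toReal hfin).mp h1
  have h2' : (Q h).toReal ≤ B := ENNReal.toReal_le_of_le_ofReal (hA.le.trans hAB) h2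
  rw [hreal] at h1' h2'
  constructor
  · rw [← div_eq_mul_inv, div_le_iff₀ hc0]; linarith
  · rw [← div_eq_mul_inv, le_div_iff₀ hc0]; linarith
end

section
/- Let H be a group, let H_n be a normal subgroup of H and H_c a subgroup of H such that every h ∈ H can be written uniquely as h = h_n h_c with h_n ∈ H_n and h_c ∈ H_c. Let Γ_n ⊆ H_n and Γ_c ⊆ H_c be countable subsets, and let s_n : H_n → ℝ and s_c : H_c → ℝ be functions satisfying ∑_{ℓ ∈ Γ_n} s_n(ℓ x)² = 1 for every x ∈ H_n and ∑_{ℓ ∈ Γ_c} s_c(ℓ y)² = 1 for every y ∈ H_c. Define s : H → ℝ by s(h) = s_n(h_n) · s_c(h_c), where h = h_n h_c is the unique factorization of h. Then for every h ∈ H, ∑_{ℓ_c ∈ Γ_c} ∑_{ℓ_n ∈ Γ_n} s(ℓ_n ℓ_c h)² = 1. -/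
/-- Let `H` be a group, `H_n` a normal subgroup and `H_c` a subgroup such
that every `h ∈ H` factors uniquely as `h = h_n h_c` with `h_n ∈ H_n`, `h_c ∈ H_c` (the
factors being computed by functions `φn`, `φc`).  Let `Γ_n ⊆ H_n`, `Γ_c ⊆ H_c` be countable
and let `s_n : H_n → ℝ`, `s_c : H_c → ℝ` satisfy `∑_{ℓ ∈ Γ_n} s_n(ℓx)² = 1` for all
`x ∈ H_n` and `∑_{ℓ ∈ Γ_c} s_c(ℓy)² = 1` for all `y ∈ H_c`.  Define
`s(h) = s_n(φn h) · s_c(φc h)`.  Then `∑_{ℓ_c ∈ Γ_c} ∑_{ℓ_n ∈ Γ_n} s(ℓ_n ℓ_c h)² = 1` for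
every `h ∈ H`. -/
theorem stmt_11 {H : Type*} [Group H] (Hn Hc : Subgroup H) [Hn.Normal]
    (φn : H → Hn) (φc : H → Hc)
    (hfact : ∀ h : H, (φn h : H) * (φc h : H) = h)
    (huniq : ∀ h : H, ∃! p : Hn × Hc, (p.1 : H) * (p.2 : H) = h)
    (Γn : Set Hn) (Γc : Set Hc) (hΓn : Γn.Countable) (hΓc : Γc.Countable)
    (sn : Hn → ℝ) (sc : Hc → ℝ)
    (hsn : ∀ x : Hn, (∑' ℓ : Γn, sn (↑ℓ * x) ^ 2) = 1)
    (hsc : ∀ y : Hc, (∑' ℓ : Γc, sc (↑ℓ * y) ^ 2) = 1)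
    (s : H → ℝ) (hs : ∀ h : H, s h = sn (φn h) * sc (φc h)) :
    ∀ h : H, (∑' q : Γn × Γc, s ((↑q.1 : H) * (↑q.2 : H) * h) ^ 2) = 1 := by
  intro h
  have sumn : ∀ x : Hn, Summable (fun ℓ : Γn => sn (↑ℓ * x) ^ 2) := by
    intro x
    by_contra hc
    have := hsn x
    rw [tsum_eq_zero_of_not_summable hc] at this
    exact zero_ne_one this
  have sumc : ∀ y : Hc, Summable (fun ℓ : Γc => sc (↑ℓ * y) ^ 2) := by
    intro x
    by_contra hc
    have := hsc x
    rw [tsum_eq_zero_of_not_summable hc] at this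
    exact zero_ne_one this
  let cj : Hc → Hn := fun l =>
    ⟨(l : H) * (φn h : H) * (l : H)⁻¹, Subgroup.Normal.conj_mem inferInstance _ (φn h).2 _⟩
  have key : ∀ (a : Hn) (l : Hc),
      s ((a : H) * (l : H) * h) = sn (a * cj l) * sc (l * φc h) := by
    intro a l
    have e : ((φn ((a : H) * (l : H) * h), φc ((a : H) * (l : H) * h)) : Hn × Hc)
        = (a * cj l, l * φc h) := by
      apply (huniq ((a : H) * (l : H) * h)).unique
      · exact hfact _
      · have h1 := hfact h
        simp only [cj, Subgroup.coe_mul]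
        conv_rhs => rw [← h1]
        group
    rw [Prod.mk.injEq] at e
    rw [hs, e.1, e.2]
  have inner : ∀ l : Γc, HasSum
      (fun a : Γn => s (((a : Hn) : H) * ((l : Hc) : H) * h) ^ 2) (sc (↑l * φc h) ^ 2) := by
    intro l
    have := ((sumn (cj l)).hasSum).mul_right (sc (↑l * φc h) ^ 2)
    rw [hsn, one_mul] at this
    simpa only [key, mul_pow] using this
  rw [← (Equiv.prodComm Γc Γn).tsum_eq]
  have hsum : Summable (fun p : Γc × Γn =>
      s (((p.2 : Hn) : H) * ((p.1 : Hc) : H) * h) ^ 2) := by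
    rw [summable_prod_of_nonneg (fun _ => sq_nonneg _)]
    refine ⟨fun l => (inner l).summable, ?_⟩
    simp only [fun l => (inner l).tsum_eq]
    exact sumc _
  have := hsum.tsum_prod' (fun l => (inner l).summable)
  simp only [fun l => (inner l).tsum_eq, hsc] at this
  exact this
end

section
/- Define Θ : ℝ² → ℝ² by Θ(t₁, t₂) = (t₁, t₁²/2 + t₂). Then the family of functions f_{m,k} : ℝ² → ℂ defined by f_{m,k}(t) = exp( 2πi ( k₁ (t₁ + m₁) + k₂ ((t₁ + m₁)²/2 + t₂ + m₂) ) ) · 1_{[-1/2,1/2)²}(t + m), i.e. f_{m,k}(t) = exp(2πi ⟨k, Θ(t + m)⟩) · 1_{[-1/2,1/2)²}(t + m), indexed by (m, k) ∈ ℤ² × ℤ², is an orthonormal Hilbert basis of L²(ℝ², Lebesgue measure). -/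
open MeasureTheory

noncomputable section

namespace Stmt14

/-- The two-dimensional torus. -/
abbrev Tor := Fin 2 → UnitAddCircle

/-- Haar probability measure on the torus. -/
def muT : Measure Tor := Measure.pi (fun _ => AddCircle.haarAddCircle)

/-- Multi-dimensional characters. -/
abbrev ch (k : Fin 2 → ℤ) : C(Tor, ℂ) := UnitAddTorus.mFourier k

lemma ch_orth (k k' : Fin 2 → ℤ) :
    ∫ u, ch k' u * (starRingEnd ℂ) (ch k u) ∂muT = if k = k' then 1 else 0 := by
  have h := (orthonormal_iff_ite.mp (UnitAddTorus.orthonormal_mFourier (d := Fin 2))) k k'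
  rw [ContinuousMap.inner_toLp] at h
  exact h

lemma ch_complete (h : Tor → ℂ) (hh : MemLp h 2 muT)
    (h0 : ∀ k, ∫ u, h u * (starRingEnd ℂ) (ch k u) ∂muT = 0) : h =ᵐ[muT] 0 := by
  have hz : hh.toLp h = 0 := by
    have hr : (UnitAddTorus.mFourierBasis (d := Fin 2)).repr (hh.toLp h) = 0 := by
      ext k
      rw [UnitAddTorus.mFourierBasis_repr]
      refine Eq.trans ?_ (h0 k)
      refine integral_congr_ae ?_
      filter_upwards [hh.coeFn_toLp] with u hu
      refine (congrArg (fun z => UnitAddTorus.mFourier (-k) u • z) hu).trans ?_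
      change UnitAddTorus.mFourier (-k) u * h u = h u * _
      rw [UnitAddTorus.mFourier_neg, mul_comm]
    exact (LinearIsometryEquiv.map_eq_zero_iff _).1 hr
  exact (MemLp.toLp_eq_toLp_iff hh MemLp.zero).1 (hz.trans (MemLp.toLp_zero _).symm)

/-- Fundamental square. -/
def Q : Set (ℝ × ℝ) := Set.Ico (-(1 / 2 : ℝ)) (1 / 2) ×ˢ Set.Ico (-(1 / 2 : ℝ)) (1 / 2)

lemma measQ : MeasurableSet Q := measurableSet_Ico.prod measurableSet_Ico

/-- The map to the torus. -/
def phi (t : ℝ × ℝ) : Tor := ![(t.1 : UnitAddCircle), ((t.1 ^ 2 / 2 + t.2 : ℝ) : UnitAddCircle)]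

/-- The representative in `[-1/2, 1/2)`. -/
def rep (x : UnitAddCircle) : ℝ := (AddCircle.equivIco 1 (-(1 / 2 : ℝ)) x : ℝ)

lemma rep_meas : Measurable rep :=
  measurable_subtype_coe.comp (AddCircle.measurableEquivIco 1 (-(1 / 2 : ℝ))).measurable

lemma rep_coe {x : ℝ} (hx : x ∈ Set.Ico (-(1 / 2 : ℝ)) (1 / 2)) : rep (x : UnitAddCircle) = x := by
  apply AddCircle.equivIco_coe_of_mem
  exact ⟨hx.1, by linarith [hx.2]⟩

/-- The section of `phi`. -/
def psi (u : Tor) : ℝ × ℝ :=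
  (rep (u 0), rep (u 1 - ((rep (u 0) ^ 2 / 2 : ℝ) : UnitAddCircle)))

lemma psi_meas : Measurable psi := by
  have h0 : Measurable fun u : Tor => rep (u 0) := rep_meas.comp (measurable_pi_apply 0)
  refine h0.prodMk (rep_meas.comp ?_)
  refine (measurable_pi_apply 1).sub (AddCircle.measurable_mk'.comp ?_)
  exact (h0.pow_const 2).div_const 2

lemma psi_phi {t : ℝ × ℝ} (ht : t ∈ Q) : psi (phi t) = t := by
  have h0 : rep (phi t 0) = t.1 := rep_coe ht.1
  have h1 : phi t 1 = ((t.1 ^ 2 / 2 + t.2 : ℝ) : UnitAddCircle) := rfl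
  unfold psi
  rw [h0, h1, ← AddCircle.coe_sub, add_sub_cancel_left, rep_coe ht.2]

lemma mk_mp : MeasurePreserving (fun x : ℝ => (x : UnitAddCircle))
    (volume.restrict (Set.Ico (-(1 / 2 : ℝ)) (1 / 2))) AddCircle.haarAddCircle := by
  have h := AddCircle.measurePreserving_mk 1 (-(1 / 2 : ℝ))
  rw [AddCircle.volume_eq_smul_haarAddCircle, ENNReal.ofReal_one, one_smul] at h
  rw [restrict_Ico_eq_restrict_Ioc]
  norm_num at h ⊢
  exact h

lemma phi_mp : MeasurePreserving phi (volume.restrict Q) muT := by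
  have hQ : (volume.restrict Q : Measure (ℝ × ℝ)) =
      (volume.restrict (Set.Ico (-(1 / 2 : ℝ)) (1 / 2))).prod
        (volume.restrict (Set.Ico (-(1 / 2 : ℝ)) (1 / 2))) := by
    rw [Measure.prod_restrict]; rfl
  have h1 := MeasurePreserving.skew_product mk_mp
    (μc := volume.restrict (Set.Ico (-(1 / 2 : ℝ)) (1 / 2)))
    (μd := (AddCircle.haarAddCircle : Measure UnitAddCircle))
    (g := fun x y => ((x ^ 2 / 2 + y : ℝ) : UnitAddCircle))
    (AddCircle.measurable_mk'.comp
      (((measurable_fst.pow_const 2).div_const 2).add measurable_snd))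
    (by
      refine Filter.Eventually.of_forall fun x => ?_
      have := ((measurePreserving_add_left (AddCircle.haarAddCircle : Measure UnitAddCircle)
        ((x ^ 2 / 2 : ℝ) : UnitAddCircle)).comp mk_mp).map_eq
      exact this)
  rw [← hQ] at h1
  exact (MeasurePreserving.symm _ (measurePreserving_finTwoArrow
    (AddCircle.haarAddCircle : Measure UnitAddCircle))).comp h1

/-- The basic functions on the square, extended by zero. -/
def E (k : ℤ × ℤ) : ℝ × ℝ → ℂ := Q.indicator fun t => ch ![k.1, k.2] (phi t)

lemma chphi_meas (k : Fin 2 → ℤ) : Measurable fun t => ch k (phi t) :=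
  (ch k).continuous.measurable.comp phi_mp.measurable

lemma E_memLp (k : ℤ × ℤ) : MemLp (E k) 2 volume := by
  unfold E
  rw [memLp_indicator_iff_restrict measQ]
  have : MemLp (ch ![k.1, k.2]) 2 muT := by
    have : IsFiniteMeasure muT := by unfold muT; infer_instance
    exact MemLp.of_bound (ch ![k.1, k.2]).continuous.aestronglyMeasurable
      ‖ch ![k.1, k.2]‖ (Filter.Eventually.of_forall fun u => (ch _).norm_coe_le_norm u)
  exact this.comp_measurePreserving phi_mp

/-- Integer translation vector. -/
def vec (m : ℤ × ℤ) : ℝ × ℝ := ((m.1 : ℝ), (m.2 : ℝ))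

lemma tr_mp (m : ℤ × ℤ) : MeasurePreserving (fun t : ℝ × ℝ => t + vec m) volume volume :=
  measurePreserving_add_right volume (vec m)

lemma F_memLp (p : (ℤ × ℤ) × (ℤ × ℤ)) : MemLp (fun t => E p.2 (t + vec p.1)) 2 volume :=
  (E_memLp p.2).comp_measurePreserving (tr_mp p.1)

/-- The basis. -/
def e (p : (ℤ × ℤ) × (ℤ × ℤ)) : Lp ℂ 2 (volume : Measure (ℝ × ℝ)) := (F_memLp p).toLp _

lemma e_coe (p : (ℤ × ℤ) × (ℤ × ℤ)) : e p =ᵐ[volume] fun t => E p.2 (t + vec p.1) :=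
  (F_memLp p).coeFn_toLp

lemma exists_cell (x : ℝ) : ∃ m : ℤ, x + m ∈ Set.Ico (-(1 / 2 : ℝ)) (1 / 2) := by
  refine ⟨-⌊x + 1 / 2⌋, ?_⟩
  have h1 := Int.floor_le (x + 1 / 2)
  have h2 := Int.lt_floor_add_one (x + 1 / 2)
  push_cast
  constructor <;> linarith

lemma cell_unique {x : ℝ} {m n : ℤ} (hm : x + m ∈ Set.Ico (-(1 / 2 : ℝ)) (1 / 2))
    (hn : x + n ∈ Set.Ico (-(1 / 2 : ℝ)) (1 / 2)) : m = n := by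
  have h1 : (m : ℝ) < n + 1 := by linarith [hm.2, hn.1]
  have h2 : (n : ℝ) < m + 1 := by linarith [hn.2, hm.1]
  norm_cast at h1 h2
  omega

lemma inner_e (p : (ℤ × ℤ) × (ℤ × ℤ)) (g : Lp ℂ 2 (volume : Measure (ℝ × ℝ))) :
    inner ℂ (e p) g = ∫ t, g t * (starRingEnd ℂ) (E p.2 (t + vec p.1)) := by
  rw [L2.inner_def]
  refine integral_congr_ae ?_
  filter_upwards [e_coe p] with t ht
  rw [ht, RCLike.inner_apply]

lemma integral_E (G : ℝ × ℝ → ℂ) (k m : ℤ × ℤ) :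
    ∫ t, G t * (starRingEnd ℂ) (E k (t + vec m)) =
      ∫ s in Q, G (s - vec m) * (starRingEnd ℂ) (ch ![k.1, k.2] (phi s)) := by
  rw [← integral_indicator measQ,
    ← integral_add_right_eq_self (Q.indicator _) (vec m)]
  congr 1
  ext t
  by_cases ht : t + vec m ∈ Q <;> simp [E, ht]

lemma e_orth : Orthonormal ℂ e := by
  rw [orthonormal_iff_ite]
  rintro ⟨m, k⟩ ⟨m', k'⟩
  rw [inner_e]
  have h1 : ∫ t, (e (m', k')) t * (starRingEnd ℂ) (E k (t + vec m)) =
      ∫ t, E k' (t + vec m') * (starRingEnd ℂ) (E k (t + vec m)) := by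
    refine integral_congr_ae ?_
    filter_upwards [e_coe (m', k')] with t ht
    rw [ht]
  refine h1.trans ?_
  by_cases hm : m = m'
  · subst hm
    rw [integral_E]
    have h2 : ∫ s in Q, E k' (s - vec m + vec m) *
        (starRingEnd ℂ) (ch ![k.1, k.2] (phi s)) =
        ∫ s in Q, ch ![k'.1, k'.2] (phi s) * (starRingEnd ℂ) (ch ![k.1, k.2] (phi s)) := by
      refine setIntegral_congr_fun measQ fun s hs => ?_
      simp [E, hs]
    rw [h2]
    have h3 := ch_orth ![k.1, k.2] ![k'.1, k'.2]
    rw [← phi_mp.map_eq, integral_map phi_mp.aemeasurable] at h3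
    · rw [h3]
      congr 1
      simp [Prod.ext_iff]
    · exact ((ch _).continuous.mul
        (Complex.continuous_conj.comp (ch _).continuous)).aestronglyMeasurable
  · rw [if_neg (by simp [hm])]
    refine integral_eq_zero_of_ae (Filter.Eventually.of_forall fun t => ?_)
    by_cases h1 : t + vec m ∈ Q
    · by_cases h2 : t + vec m' ∈ Q
      · exact absurd (Prod.ext (cell_unique h1.1 h2.1) (cell_unique h1.2 h2.2)) hm
      · simp [E, h2]
    · simp [E, h1]

lemma e_complete (g : Lp ℂ 2 (volume : Measure (ℝ × ℝ)))
    (hg : ∀ p, inner ℂ (e p) g = 0) : g = 0 := by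
  have key : ∀ m : ℤ × ℤ, ∀ᵐ t : ℝ × ℝ, t + vec m ∈ Q → g t = 0 := by
    intro m
    have hsub : MeasurePreserving (fun t : ℝ × ℝ => t - vec m) volume volume :=
      measurePreserving_sub_right volume (vec m)
    have hG : MemLp (fun s => g (s - vec m)) 2 (volume.restrict Q) :=
      ((Lp.memLp g).comp_measurePreserving hsub).restrict Q
    have hmeas : Measurable fun u : Tor => g (psi u - vec m) :=
      (Lp.stronglyMeasurable g).measurable.comp (psi_meas.sub_const _)
    have hcongr : (fun s => g (psi (phi s) - vec m)) =ᵐ[volume.restrict Q]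
        fun s => g (s - vec m) := by
      filter_upwards [ae_restrict_mem measQ] with s hs
      rw [psi_phi hs]
    have hh : MemLp (fun u : Tor => g (psi u - vec m)) 2 muT := by
      rw [← phi_mp.map_eq, memLp_map_measure_iff hmeas.aestronglyMeasurable phi_mp.aemeasurable]
      exact hG.ae_eq hcongr.symm
    have hz := ch_complete _ hh (by
      intro k
      rw [← phi_mp.map_eq, integral_map phi_mp.aemeasurable]
      · have h1 := hg (m, (k 0, k 1))
        rw [inner_e, integral_E] at h1
        refine Eq.trans (integral_congr_ae ?_) h1
        have hk : ![k 0, k 1] = k := by ext i; fin_cases i <;> rfl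
        filter_upwards [hcongr] with s hs
        simp only [hk]
        rw [hs]
      · exact (hmeas.mul (Complex.continuous_conj.comp
          (ch _).continuous).measurable).aestronglyMeasurable)
    have h2 := phi_mp.quasiMeasurePreserving.ae hz
    have h3 : ∀ᵐ s ∂(volume.restrict Q), g (s - vec m) = 0 := by
      filter_upwards [h2, hcongr] with s hs hs'
      rw [← hs']; exact hs
    rw [ae_restrict_iff' measQ] at h3
    have h4 := (tr_mp m).quasiMeasurePreserving.ae h3
    filter_upwards [h4] with t ht hQ
    simpa using ht hQ
  rw [Lp.eq_zero_iff_ae_eq_zero]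
  filter_upwards [ae_all_iff.2 key] with t ht
  obtain ⟨a, ha⟩ := exists_cell t.1
  obtain ⟨b, hb⟩ := exists_cell t.2
  exact ht (a, b) ⟨ha, hb⟩

lemma e_formula (p : (ℤ × ℤ) × (ℤ × ℤ)) (t : ℝ × ℝ) : E p.2 (t + vec p.1) =
        Complex.exp (2 * Real.pi * Complex.I *
            ((((p.2.1 : ℝ) * (t.1 + (p.1.1 : ℝ)) +
               (p.2.2 : ℝ) * ((t.1 + (p.1.1 : ℝ)) ^ 2 / 2 + t.2 + (p.1.2 : ℝ)) : ℝ) : ℂ))) *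
          Set.indicator (Set.Ico (-(1 / 2 : ℝ)) (1 / 2) ×ˢ Set.Ico (-(1 / 2 : ℝ)) (1 / 2))
            (fun _ => (1 : ℂ)) (t + ((p.1.1 : ℝ), (p.1.2 : ℝ))) := by
  change E p.2 (t + vec p.1) = _ * Q.indicator (fun _ => (1 : ℂ)) (t + vec p.1)
  by_cases h : t + vec p.1 ∈ Q
  · rw [E, Set.indicator_of_mem h, Set.indicator_of_mem h, mul_one]
    have : ch ![p.2.1, p.2.2] (phi (t + vec p.1)) =
      fourier p.2.1 (((t + vec p.1).1 : ℝ) : UnitAddCircle) *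
      fourier p.2.2 ((((t + vec p.1).1 ^ 2 / 2 + (t + vec p.1).2 : ℝ)) : UnitAddCircle) := by
      simp [ch, UnitAddTorus.mFourier, phi, Fin.prod_univ_two]
    rw [this, fourier_coe_apply, fourier_coe_apply, ← Complex.exp_add]
    congr 1
    simp [vec]
    ring
  · rw [E, Set.indicator_of_notMem h, Set.indicator_of_notMem h, mul_zero]

end Stmt14

end


/-- With `Θ(t₁,t₂) = (t₁, t₁²/2 + t₂)`, the family
`f_{m,k}(t) = exp(2πi⟨k, Θ(t + m)⟩) · 1_{[-1/2,1/2)²}(t + m)`, indexed by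
`(m, k) ∈ ℤ² × ℤ²`, is an orthonormal Hilbert basis of `L²(ℝ²)`.  (Example 3.4 of the
paper.) -/
theorem stmt_14 :
    ∃ e : (ℤ × ℤ) × (ℤ × ℤ) → Lp ℂ 2 (volume : Measure (ℝ × ℝ)),
      (∀ p : (ℤ × ℤ) × (ℤ × ℤ), ⇑(e p) =ᵐ[(volume : Measure (ℝ × ℝ))] fun t : ℝ × ℝ =>
        Complex.exp (2 * Real.pi * Complex.I *
            ((((p.2.1 : ℝ) * (t.1 + (p.1.1 : ℝ)) +
               (p.2.2 : ℝ) * ((t.1 + (p.1.1 : ℝ)) ^ 2 / 2 + t.2 + (p.1.2 : ℝ)) : ℝ) : ℂ))) *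
          Set.indicator (Set.Ico (-(1 / 2 : ℝ)) (1 / 2) ×ˢ Set.Ico (-(1 / 2 : ℝ)) (1 / 2))
            (fun _ => (1 : ℂ)) (t + ((p.1.1 : ℝ), (p.1.2 : ℝ)))) ∧
      Orthonormal ℂ e ∧
      (Submodule.span ℂ (Set.range e)).topologicalClosure = ⊤ := by
  refine ⟨Stmt14.e, fun p => ?_, Stmt14.e_orth, ?_⟩
  · filter_upwards [Stmt14.e_coe p] with t ht
    rw [ht, Stmt14.e_formula]
  · rw [Submodule.topologicalClosure_eq_top_iff, Submodule.eq_bot_iff]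
    intro g hg
    exact Stmt14.e_complete g fun p =>
      (Submodule.mem_orthogonal _ _).1 hg _ (Submodule.subset_span ⟨p, rfl⟩)
end

section
/- For (v, s) ∈ ℝ² × ℝ² and f ∈ L²(ℝ²), define the unitary operator π(v, s) on L²(ℝ²) by [π(v, s) f](t₁, t₂) = exp( 2πi ( v₁ e^{-t₂} - v₂ e^{-t₂} t₁ ) ) · f(t₁ - s₁, t₂ - s₂). Then for every continuous, compactly supported function f : ℝ² → ℂ which is not identically zero, there exist countable sets Λ ⊆ ℝ² and M ⊆ ℝ² and constants 0 < A ≤ B < ∞ such that the family of functions g_{ℓ, v}(t) = exp( 2πi ( v₁ e^{-(t₂ + ℓ₂)} - v₂ e^{-(t₂ + ℓ₂)} (t₁ + ℓ₁) ) ) · f(t₁ + ℓ₁, t₂ + ℓ₂), indexed by (ℓ, v) ∈ Λ × M, is a frame for L²(ℝ²): A‖g‖² ≤ ∑_{(ℓ,v) ∈ Λ × M} |⟨g, g_{ℓ,v}⟩|² ≤ B‖g‖² for all g ∈ L²(ℝ²). -/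
open MeasureTheory

theorem memLp_two_of_lintegral {α : Type*} [MeasurableSpace α] {μ : Measure α} {H : α → ℂ}
    (hm : Measurable H) (hfin : ∫⁻ x, ‖H x‖ₑ ^ 2 ∂μ < ⊤) : MemLp H 2 μ := by
  refine ⟨hm.aestronglyMeasurable, ?_⟩
  rw [eLpNorm_lt_top_iff_lintegral_rpow_enorm_lt_top (by norm_num) (by norm_num)]
  simpa using hfin

theorem parseval_one (T a : ℝ) (hT : 0 < T) (H : ℝ → ℂ) (hm : Measurable H)
    (hs : ∀ x, H x ≠ 0 → x ∈ Set.Ioc a (a + T)) (hfin : ∫⁻ x, ‖H x‖ₑ ^ 2 < ⊤) :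
    ∑' n : ℤ, ‖∫ x, Complex.exp (2 * Real.pi * Complex.I * ((n / T * x : ℝ) : ℂ)) * H x‖ₑ ^ 2
      = ENNReal.ofReal T * ∫⁻ x, ‖H x‖ₑ ^ 2 := by
  have hab : a < a + T := by linarith
  have hL := memLp_two_of_lintegral hm hfin
  have key := hasSum_sq_fourierCoeffOn hab (hL.restrict (Set.Ioc a (a + T)))
  have hintegrable : ∫ x in a..(a + T), ‖H x‖ ^ 2 = ∫ x, ‖H x‖ ^ 2 := by
    rw [intervalIntegral.integral_of_le hab.le]
    apply setIntegral_eq_integral_of_forall_compl_eq_zero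
    intro x hx
    have : H x = 0 := by
      by_contra h
      exact hx (hs x h)
    simp [this]
  have hcoef : ∀ n : ℤ, ‖fourierCoeffOn hab H (-n)‖ ^ 2 = (1 / T) ^ 2 *
      ‖∫ x, Complex.exp (2 * Real.pi * Complex.I * ((n / T * x : ℝ) : ℂ)) * H x‖ ^ 2 := by
    intro n
    rw [fourierCoeffOn_eq_integral, norm_smul, mul_pow, intervalIntegral.integral_of_le hab.le,
      setIntegral_eq_integral_of_forall_compl_eq_zero]
    · congr 2
      · simp [hT.le]
      · congr 1
        apply integral_congr_ae
        filter_upwards with x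
        rw [fourier_coe_apply]
        simp only [smul_eq_mul, neg_neg]
        congr 2
        push_cast
        ring
    · intro x hx
      have : H x = 0 := by
        by_contra h
        exact hx (hs x h)
      simp [this]
  rw [hintegrable] at key
  have key2 := ((Equiv.neg ℤ).hasSum_iff.mpr key).mul_left (T ^ 2)
  have e1 : ∀ n : ℤ, T ^ 2 * ((fun i => ‖fourierCoeffOn hab H i‖ ^ 2) ∘ (Equiv.neg ℤ)) n =
      ‖∫ x, Complex.exp (2 * Real.pi * Complex.I * ((n / T * x : ℝ) : ℂ)) * H x‖ ^ 2 := by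
    intro n
    simp only [Function.comp, Equiv.neg_apply]
    rw [hcoef]
    field_simp
  rw [show T ^ 2 * ((a + T - a)⁻¹ • ∫ x, ‖H x‖ ^ 2) = T * ∫ x, ‖H x‖ ^ 2 by
    rw [smul_eq_mul, add_sub_cancel_left]; field_simp] at key2
  simp only [e1] at key2
  have e2 : ∀ z : ℂ, ‖z‖ₑ ^ 2 = ENNReal.ofReal (‖z‖ ^ 2) := by
    intro z
    rw [ENNReal.ofReal_pow (norm_nonneg _), ofReal_norm]
  simp only [e2]
  rw [← ENNReal.ofReal_tsum_of_nonneg (fun _ => by positivity) key2.summable, key2.tsum_eq,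
    ENNReal.ofReal_mul hT.le]
  congr 1
  apply ofReal_integral_eq_lintegral_ofReal
  · exact (memLp_two_iff_integrable_sq_norm hm.aestronglyMeasurable).mp hL
  · filter_upwards with x using by positivity

theorem parseval_subst (T a : ℝ) (hT : 0 < T) (φ φ' ψ : ℝ → ℝ) (hφ' : ∀ s, HasDerivAt φ (φ' s) s)
    (hne : ∀ s, φ' s ≠ 0) (hψ : ∀ s, ψ (φ s) = s) (hψm : Measurable ψ) (hφm : Measurable φ')
    (hr : MeasurableSet (Set.range φ)) (h : ℝ → ℂ) (hm : Measurable h)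
    (hs : ∀ s, h s ≠ 0 → φ s ∈ Set.Ioc a (a + T))
    (hfin : ∫⁻ s, ‖h s‖ₑ ^ 2 * ENNReal.ofReal (|φ' s|⁻¹) < ⊤) :
    ∑' n : ℤ, ‖∫ s, Complex.exp (2 * Real.pi * Complex.I * ((n / T * φ s : ℝ) : ℂ)) * h s‖ₑ ^ 2
      = ENNReal.ofReal T * ∫⁻ s, ‖h s‖ₑ ^ 2 * ENNReal.ofReal (|φ' s|⁻¹) := by
  set H : ℝ → ℂ := (Set.range φ).indicator (fun x => ((|φ' (ψ x)|⁻¹ : ℝ) : ℂ) * h (ψ x)) with hH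
  have hHm : Measurable H := by
    apply Measurable.indicator _ hr
    have h1 : Measurable (fun x => |φ' (ψ x)|⁻¹) := by fun_prop
    exact (Complex.measurable_ofReal.comp h1).mul (hm.comp hψm)
  have hHφ : ∀ s, H (φ s) = ((|φ' s|⁻¹ : ℝ) : ℂ) * h s := by
    intro s
    rw [hH, Set.indicator_of_mem (Set.mem_range_self s)]
    simp only [hψ]
  have hH0 : ∀ x, x ∉ Set.range φ → H x = 0 := fun x hx => Set.indicator_of_notMem hx _
  have hinj : Set.InjOn φ Set.univ := (Function.LeftInverse.injective hψ).injOn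
  have hl : ∫⁻ x, ‖H x‖ₑ ^ 2 = ∫⁻ s, ‖h s‖ₑ ^ 2 * ENNReal.ofReal (|φ' s|⁻¹) := by
    have h1 : ∫⁻ x, ‖H x‖ₑ ^ 2 = ∫⁻ x in φ '' Set.univ, ‖H x‖ₑ ^ 2 := by
      rw [Set.image_univ]
      symm
      apply setLIntegral_eq_of_support_subset
      intro x hx
      by_contra h
      simp [hH0 x h] at hx
    rw [h1, lintegral_image_eq_lintegral_abs_deriv_mul MeasurableSet.univ
      (fun x _ => (hφ' x).hasDerivWithinAt) hinj, setLIntegral_univ]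
    congr 1
    ext s
    have hp : 0 < |φ' s| := abs_pos.mpr (hne s)
    rw [hHφ, enorm_mul, mul_pow, mul_comm (‖h s‖ₑ ^ 2), ← mul_assoc]
    congr 1
    generalize |φ' s| = q at hp
    rw [← ofReal_norm, Complex.norm_real, Real.norm_eq_abs, abs_of_pos (by positivity),
      ← ENNReal.ofReal_pow (by positivity), ← ENNReal.ofReal_mul (by positivity)]
    congr 1
    field_simp
  have hi : ∀ n : ℤ,
      ∫ s, Complex.exp (2 * Real.pi * Complex.I * ((n / T * φ s : ℝ) : ℂ)) * h s =
      ∫ x, Complex.exp (2 * Real.pi * Complex.I * ((n / T * x : ℝ) : ℂ)) * H x := by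
    intro n
    rw [← setIntegral_eq_integral_of_forall_compl_eq_zero (s := φ '' Set.univ)
      (f := fun x : ℝ => Complex.exp (2 * Real.pi * Complex.I * ((n / T * x : ℝ) : ℂ)) * H x),
      integral_image_eq_integral_abs_deriv_smul MeasurableSet.univ
      (fun x _ => (hφ' x).hasDerivWithinAt) hinj, setIntegral_univ]
    · congr 1
      ext s
      have hp : ((|φ' s| : ℝ) : ℂ) ≠ 0 := by exact_mod_cast (abs_pos.mpr (hne s)).ne'
      rw [hHφ, Complex.real_smul]
      push_cast
      field_simp
    · intro x hx
      rw [Set.image_univ] at hx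
      simp [hH0 x hx]
  simp only [hi]
  rw [← hl]
  apply parseval_one T a hT H hHm
  · intro x hx
    by_cases hxr : x ∈ Set.range φ
    · obtain ⟨s, rfl⟩ := hxr
      apply hs
      intro h0
      simp [hHφ, h0] at hx
    · exact absurd (hH0 x hxr) hx
  · rw [hl]; exact hfin

theorem parseval_lin (T c : ℝ) (hT : 0 < T) (hc : 0 < c) (h : ℝ → ℂ) (hm : Measurable h)
    (hs : ∀ s, h s ≠ 0 → |c * s| < T / 2) (hfin : ∫⁻ s, ‖h s‖ₑ ^ 2 < ⊤) :
    ∑' n : ℤ, ‖∫ s, Complex.exp (2 * Real.pi * Complex.I * ((n / T * (-c * s) : ℝ) : ℂ)) * h s‖ₑ ^ 2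
      = ENNReal.ofReal T * ((∫⁻ s, ‖h s‖ₑ ^ 2) * ENNReal.ofReal c⁻¹) := by
  have e : ∫⁻ s, ‖h s‖ₑ ^ 2 * ENNReal.ofReal (|-c|⁻¹) =
      (∫⁻ s, ‖h s‖ₑ ^ 2) * ENNReal.ofReal c⁻¹ := by
    rw [lintegral_mul_const _ (by fun_prop), abs_neg, abs_of_pos hc]
  rw [← e]
  refine parseval_subst T (-(T / 2)) hT (fun s => -c * s) (fun _ => -c) (fun x => -x / c)
    ?_ ?_ ?_ ?_ ?_ ?_ h hm ?_ ?_
  · intro s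
    simpa using (hasDerivAt_id s).const_mul (-c)
  · intro s
    simpa using hc.ne'
  · intro s
    field_simp
  · fun_prop
  · fun_prop
  · rw [Set.range_eq_univ.mpr]
    · exact MeasurableSet.univ
    · intro x
      refine ⟨-x / c, ?_⟩
      field_simp
  · intro s h0
    have := abs_lt.mp (hs s h0)
    constructor <;> simp <;> linarith
  · rw [e]
    exact ENNReal.mul_lt_top hfin ENNReal.ofReal_lt_top

theorem parseval_exp (T : ℝ) (hT : 0 < T) (h : ℝ → ℂ) (hm : Measurable h)
    (hs : ∀ s, h s ≠ 0 → Real.exp (-s) < T / 2)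
    (hfin : ∫⁻ s, ‖h s‖ₑ ^ 2 * ENNReal.ofReal (Real.exp s) < ⊤) :
    ∑' n : ℤ, ‖∫ s, Complex.exp (2 * Real.pi * Complex.I * ((n / T * Real.exp (-s) : ℝ) : ℂ)) * h s‖ₑ ^ 2
      = ENNReal.ofReal T * ∫⁻ s, ‖h s‖ₑ ^ 2 * ENNReal.ofReal (Real.exp s) := by
  have e : ∀ s : ℝ, Real.exp s = |(-Real.exp (-s))|⁻¹ := by
    intro s
    rw [abs_neg, abs_of_pos (Real.exp_pos _), Real.exp_neg, inv_inv]
  simp_rw [fun s => congrArg ENNReal.ofReal (e s)] at hfin ⊢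
  refine parseval_subst T (-(T / 2)) hT (fun s => Real.exp (-s)) (fun s => -Real.exp (-s))
    (fun x => -Real.log x) ?_ ?_ ?_ ?_ ?_ ?_ h hm ?_ hfin
  · intro s
    simpa using (hasDerivAt_neg s).exp
  · intro s
    exact neg_ne_zero.mpr (Real.exp_pos _).ne'
  · intro s
    simp
  · fun_prop
  · fun_prop
  · have : Set.range (fun s => Real.exp (-s)) = Set.Ioi 0 := by
      ext x
      constructor
      · rintro ⟨s, rfl⟩
        exact Real.exp_pos _
      · intro hx
        exact ⟨-Real.log x, by simpa using Real.exp_log hx⟩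
    rw [this]
    exact measurableSet_Ioi
  · intro s h0
    have := hs s h0
    have := Real.exp_pos (-s)
    constructor <;> linarith

theorem norm_phase (x : ℝ) : ‖Complex.exp (2 * Real.pi * Complex.I * (x : ℂ))‖ = 1 := by
  rw [show (2 * Real.pi * Complex.I * (x : ℂ)) = ((2 * Real.pi * x : ℝ) : ℂ) * Complex.I by
    push_cast; ring]
  exact Complex.norm_exp_ofReal_mul_I _

theorem parseval_two (R T : ℝ) (hR : 0 < R) (hT : T / 2 = Real.exp R * (R + 1)) (h : ℝ × ℝ → ℂ)
    (hm : Measurable h) (hs : ∀ s, h s ≠ 0 → |s.1| ≤ R ∧ |s.2| ≤ R)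
    (hfin : ∫⁻ s, ‖h s‖ₑ ^ 2 < ⊤) :
    ∑' n : ℤ × ℤ, ‖∫ s : ℝ × ℝ, Complex.exp (2 * Real.pi * Complex.I *
        ((n.1 / T * Real.exp (-s.2) - n.2 / T * Real.exp (-s.2) * s.1 : ℝ) : ℂ)) * h s‖ₑ ^ 2
      = ENNReal.ofReal T * (ENNReal.ofReal T *
          ∫⁻ s, ‖h s‖ₑ ^ 2 * ENNReal.ofReal (Real.exp s.2) ^ 2) := by
  have hTpos : 0 < T := by
    have : 0 < Real.exp R * (R + 1) := by positivity
    linarith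
  have hL := memLp_two_of_lintegral hm hfin
  -- integrability
  have hintegrable : Integrable h := by
    have hK : IsCompact (Set.Icc (-R) R ×ˢ Set.Icc (-R) R) := isCompact_Icc.prod isCompact_Icc
    have : IntegrableOn h (Set.Icc (-R) R ×ˢ Set.Icc (-R) R) := by
      have : IsFiniteMeasure (volume.restrict (Set.Icc (-R) R ×ˢ Set.Icc (-R) R)) :=
        ⟨by simpa using hK.measure_lt_top⟩
      exact (hL.restrict _).integrable (by norm_num)
    rwa [integrableOn_iff_integrable_of_support_subset] at this
    intro s h0
    have := hs s h0
    exact ⟨abs_le.mp this.1, abs_le.mp this.2⟩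
  set G : ℤ → ℝ → ℂ := fun n y => ∫ x, Complex.exp (2 * Real.pi * Complex.I *
        ((n / T * (-Real.exp (-y) * x) : ℝ) : ℂ)) * h (x, y) with hG
  have hGm : ∀ n, Measurable (G n) := by
    intro n
    have h1 : Measurable (fun p : ℝ × ℝ => Complex.exp (2 * Real.pi * Complex.I *
        ((n / T * (-Real.exp (-p.2) * p.1) : ℝ) : ℂ)) * h p) := by fun_prop
    exact (h1.stronglyMeasurable.integral_prod_left').measurable
  have hGs : ∀ n y, G n y ≠ 0 → |y| ≤ R := by
    intro n y h0
    by_contra hy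
    apply h0
    simp only [hG]
    rw [← integral_zero ℝ ℂ]
    congr 1
    ext x
    have : h (x, y) = 0 := by
      by_contra h1
      exact hy (hs _ h1).2
    simp [this]
  have hfub : ∀ n : ℤ × ℤ, ∫ s : ℝ × ℝ, Complex.exp (2 * Real.pi * Complex.I *
        ((n.1 / T * Real.exp (-s.2) - n.2 / T * Real.exp (-s.2) * s.1 : ℝ) : ℂ)) * h s =
      ∫ y, Complex.exp (2 * Real.pi * Complex.I * ((n.1 / T * Real.exp (-y) : ℝ) : ℂ)) *
        G n.2 y := by
    intro n
    rw [Measure.volume_eq_prod, integral_prod_symm]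
    · congr 1
      ext y
      simp only [hG]
      rw [← integral_const_mul]
      congr 1
      ext x
      rw [← mul_assoc, ← Complex.exp_add]
      congr 2
      push_cast
      ring
    · rw [← Measure.volume_eq_prod]
      refine hintegrable.bdd_mul (c := 1) ?_ ?_
      · exact Measurable.aestronglyMeasurable (by fun_prop)
      · filter_upwards with s
        exact (norm_phase _).le
  have hml : Measurable (fun y => ∫⁻ x, ‖h (x, y)‖ₑ ^ 2) :=
    Measurable.lintegral_prod_left' (f := fun p => ‖h p‖ₑ ^ 2) (by fun_prop)
  have hton : ∫⁻ s, ‖h s‖ₑ ^ 2 = ∫⁻ y, ∫⁻ x, ‖h (x, y)‖ₑ ^ 2 := by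
    rw [Measure.volume_eq_prod, lintegral_prod_symm' _ (by fun_prop)]
  have hae : ∀ᵐ y : ℝ, ∫⁻ x, ‖h (x, y)‖ₑ ^ 2 < ⊤ := by
    apply ae_lt_top hml
    rw [← hton]
    exact hfin.ne
  have hsum : ∫⁻ y, ∑' n, ‖G n y‖ₑ ^ 2 * ENNReal.ofReal (Real.exp y) =
      ENNReal.ofReal T * ∫⁻ s, ‖h s‖ₑ ^ 2 * ENNReal.ofReal (Real.exp s.2) ^ 2 := by
    rw [Measure.volume_eq_prod, lintegral_prod_symm' _ (by fun_prop), ← lintegral_const_mul]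
    · apply lintegral_congr_ae
      filter_upwards [hae] with y hy
      rw [ENNReal.tsum_mul_right]
      simp only [hG]
      rw [parseval_lin T (Real.exp (-y)) hTpos (Real.exp_pos _) (fun x => h (x, y)) (by fun_prop)
        _ hy, lintegral_mul_const _ (by fun_prop), Real.exp_neg, inv_inv]
      · ring
      · intro x h0
        have h1 := hs _ h0
        simp only at h1
        rw [hT, abs_mul, abs_of_pos (Real.exp_pos _)]
        have h2 : Real.exp (-y) ≤ Real.exp R := by
          apply Real.exp_le_exp.mpr
          linarith [neg_abs_le y]
        have h3 := Real.exp_pos R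
        calc Real.exp (-y) * |x| ≤ Real.exp R * R :=
              mul_le_mul h2 h1.1 (abs_nonneg _) h3.le
          _ < _ := by nlinarith
    · exact Measurable.lintegral_prod_left'
        (f := fun p => ‖h p‖ₑ ^ 2 * ENNReal.ofReal (Real.exp p.2) ^ 2) (by fun_prop)
  have hfin2 : ∫⁻ s, ‖h s‖ₑ ^ 2 * ENNReal.ofReal (Real.exp s.2) ^ 2 < ⊤ := by
    calc ∫⁻ s, ‖h s‖ₑ ^ 2 * ENNReal.ofReal (Real.exp s.2) ^ 2
        ≤ ∫⁻ s, ‖h s‖ₑ ^ 2 * ENNReal.ofReal (Real.exp R) ^ 2 := by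
          apply lintegral_mono
          intro s
          by_cases h0 : h s = 0
          · simp [h0]
          · have := (hs s h0).2
            have h2 : Real.exp s.2 ≤ Real.exp R := Real.exp_le_exp.mpr ((le_abs_self _).trans this)
            dsimp only
            gcongr
      _ < ⊤ := by
          rw [lintegral_mul_const _ (by fun_prop)]
          exact ENNReal.mul_lt_top hfin (ENNReal.pow_lt_top ENNReal.ofReal_lt_top)
  have hsum2 : ∑' n, ∫⁻ y, ‖G n y‖ₑ ^ 2 * ENNReal.ofReal (Real.exp y) =
      ENNReal.ofReal T * ∫⁻ s, ‖h s‖ₑ ^ 2 * ENNReal.ofReal (Real.exp s.2) ^ 2 := by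
    rw [← hsum, lintegral_tsum]
    intro n
    have := hGm n
    fun_prop
  have hGfin : ∀ n, ∫⁻ y, ‖G n y‖ₑ ^ 2 * ENNReal.ofReal (Real.exp y) < ⊤ := by
    intro n
    refine lt_of_le_of_lt (ENNReal.le_tsum (f := fun n => ∫⁻ y, ‖G n y‖ₑ ^ 2 * ENNReal.ofReal (Real.exp y)) n) ?_
    rw [hsum2]
    exact ENNReal.mul_lt_top ENNReal.ofReal_lt_top hfin2
  rw [← hsum2, ENNReal.tsum_prod', ENNReal.tsum_comm, ← ENNReal.tsum_mul_left]
  congr 1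
  ext n
  have hfub' := fun k : ℤ => hfub (k, n)
  simp only at hfub'
  simp only [hfub']
  apply parseval_exp T hTpos (G n) (hGm n) _ (hGfin n)
  intro y h0
  have h1 := hGs n y h0
  rw [hT]
  have h2 : Real.exp (-y) ≤ Real.exp R := by
    apply Real.exp_le_exp.mpr
    linarith [neg_abs_le y]
  have h3 := Real.exp_pos R
  nlinarith

theorem count_one (δ R : ℝ) (hδ : 0 < δ) :
    ∃ N : ℕ, ∀ t : ℝ, ∃ S : Finset ℤ, S.card ≤ N ∧ ∀ m : ℤ, |t + m * δ| ≤ R → m ∈ S := by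
  refine ⟨(⌈2 * R / δ⌉ + 1).toNat, fun t => ⟨Finset.Icc ⌈(-R - t) / δ⌉ ⌊(R - t) / δ⌋, ?_, ?_⟩⟩
  · rw [Int.card_Icc]
    apply Int.toNat_le_toNat
    have h1 := Int.floor_le ((R - t) / δ)
    have h2 := Int.le_ceil ((-R - t) / δ)
    have h3 := Int.le_ceil (2 * R / δ)
    have h4 : (R - t) / δ - (-R - t) / δ = 2 * R / δ := by ring
    have h5 : ((⌊(R - t) / δ⌋ - ⌈(-R - t) / δ⌉ : ℤ) : ℝ) ≤ ((⌈2 * R / δ⌉ : ℤ) : ℝ) := by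
      push_cast
      linarith
    have h6 := Int.cast_le.mp h5
    linarith
  · intro m hm
    have := abs_le.mp hm
    rw [Finset.mem_Icc]
    constructor
    · apply Int.ceil_le.mpr
      rw [div_le_iff₀ hδ]
      linarith
    · apply Int.le_floor.mpr
      rw [le_div_iff₀ hδ]
      linarith

theorem exists_shift (δ : ℝ) (hδ : 0 < δ) (t a : ℝ) : ∃ m : ℤ, |t + m * δ - a| ≤ δ := by
  refine ⟨⌊(a - t) / δ⌋, ?_⟩
  have h1 := Int.floor_le ((a - t) / δ)
  have h2 := Int.lt_floor_add_one ((a - t) / δ)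
  rw [le_div_iff₀ hδ] at h1
  rw [div_lt_iff₀ hδ] at h2
  rw [abs_le]
  constructor <;> nlinarith

theorem periodize (F : ℝ × ℝ → ENNReal) (δ R : ℝ) (hδ : 0 < δ) (C c : ENNReal)
    (hC : ∀ s, F s ≤ C) (hs : ∀ s, F s ≠ 0 → |s.1| ≤ R ∧ |s.2| ≤ R) (a : ℝ × ℝ)
    (hc : ∀ s : ℝ × ℝ, |s.1 - a.1| ≤ δ → |s.2 - a.2| ≤ δ → c ≤ F s) :
    ∃ N : ℕ, ∀ t : ℝ × ℝ, c ≤ ∑' m : ℤ × ℤ, F (t + ((m.1 : ℝ) * δ, (m.2 : ℝ) * δ)) ∧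
      ∑' m : ℤ × ℤ, F (t + ((m.1 : ℝ) * δ, (m.2 : ℝ) * δ)) ≤ N * C := by
  obtain ⟨N, hN⟩ := count_one δ R hδ
  refine ⟨N * N, fun t => ⟨?_, ?_⟩⟩
  · obtain ⟨m1, h1⟩ := exists_shift δ hδ t.1 a.1
    obtain ⟨m2, h2⟩ := exists_shift δ hδ t.2 a.2
    refine le_trans ?_ (ENNReal.le_tsum (m1, m2))
    exact hc _ h1 h2
  · obtain ⟨S1, hS1, hm1⟩ := hN t.1
    obtain ⟨S2, hS2, hm2⟩ := hN t.2
    rw [tsum_eq_sum (s := S1 ×ˢ S2)]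
    · refine (Finset.sum_le_card_nsmul _ _ C (fun m _ => hC _)).trans ?_
      rw [nsmul_eq_mul, Finset.card_product]
      gcongr
    · intro m hm
      by_contra h0
      apply hm
      have := hs _ h0
      exact Finset.mem_product.mpr ⟨hm1 _ this.1, hm2 _ this.2⟩

theorem summable_of_enn {ι : Type*} (F : ι → ℂ) (x A B : ℝ) (hx : 0 ≤ x) (hA : 0 ≤ A) (hB : 0 ≤ B)
    (h1 : ENNReal.ofReal A * ENNReal.ofReal x ≤ ∑' i, ‖F i‖ₑ ^ 2)
    (h2 : ∑' i, ‖F i‖ₑ ^ 2 ≤ ENNReal.ofReal B * ENNReal.ofReal x) :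
    Summable (fun i => ‖F i‖ ^ 2) ∧ A * x ≤ ∑' i, ‖F i‖ ^ 2 ∧ ∑' i, ‖F i‖ ^ 2 ≤ B * x := by
  have e2 : ∀ z : ℂ, ‖z‖ₑ ^ 2 = ENNReal.ofReal (‖z‖ ^ 2) := by
    intro z
    rw [ENNReal.ofReal_pow (norm_nonneg _), ofReal_norm]
  have hS : Summable (fun i => ‖F i‖ ^ 2) := by
    have : ∑' i, ((‖F i‖₊ ^ 2 : NNReal) : ENNReal) ≠ ⊤ := by
      refine ne_top_of_le_ne_top (ENNReal.mul_ne_top (b := ENNReal.ofReal x)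
        (ENNReal.ofReal_ne_top (r := B)) ENNReal.ofReal_ne_top) ?_
      simpa [enorm_eq_nnnorm] using h2
    have h3 := NNReal.summable_coe.mpr (ENNReal.tsum_coe_ne_top_iff_summable.mp this)
    simpa using h3
  refine ⟨hS, ?_⟩
  simp only [e2] at h1 h2
  rw [← ENNReal.ofReal_tsum_of_nonneg (fun _ => by positivity) hS,
    ← ENNReal.ofReal_mul (by assumption)] at h1 h2
  have hn : 0 ≤ ∑' i, ‖F i‖ ^ 2 := tsum_nonneg (fun _ => by positivity)
  exact ⟨(ENNReal.ofReal_le_ofReal_iff hn).mp h1,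
    (ENNReal.ofReal_le_ofReal_iff (by positivity)).mp h2⟩

theorem frame_sum (R T δ : ℝ) (hR : 0 < R) (hT : T / 2 = Real.exp R * (R + 1))
    (f : ℝ × ℝ → ℂ) (hfm : Measurable f) (hs : ∀ s, f s ≠ 0 → |s.1| ≤ R ∧ |s.2| ≤ R)
    (C : NNReal) (hC : ∀ s, ‖f s‖ₑ ≤ C)
    (u : ℝ × ℝ → ℂ) (hu : Measurable u) (hfin : ∫⁻ t, ‖u t‖ₑ ^ 2 < ⊤) :
    ∑' m : ℤ × ℤ, ∑' n : ℤ × ℤ, ‖∫ s : ℝ × ℝ, Complex.exp (2 * Real.pi * Complex.I *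
        ((n.1 / T * Real.exp (-s.2) - n.2 / T * Real.exp (-s.2) * s.1 : ℝ) : ℂ)) *
        (f s * starRingEnd ℂ (u (s - ((m.1 : ℝ) * δ, (m.2 : ℝ) * δ))))‖ₑ ^ 2
      = ENNReal.ofReal T * (ENNReal.ofReal T *
        ∫⁻ t, ‖u t‖ₑ ^ 2 * ∑' m : ℤ × ℤ, (fun s : ℝ × ℝ => ‖f s‖ₑ ^ 2 *
          ENNReal.ofReal (Real.exp s.2) ^ 2) (t + ((m.1 : ℝ) * δ, (m.2 : ℝ) * δ))) := by
  have hmeas : ∀ ℓ : ℝ × ℝ, Measurable (fun s => f s * starRingEnd ℂ (u (s - ℓ))) := by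
    intro ℓ
    have h1 : Measurable (fun s => u (s - ℓ)) := by fun_prop
    exact hfm.mul (RCLike.continuous_conj.measurable.comp h1)
  have hen : ∀ (ℓ s : ℝ × ℝ), ‖f s * starRingEnd ℂ (u (s - ℓ))‖ₑ ^ 2 =
      ‖f s‖ₑ ^ 2 * ‖u (s - ℓ)‖ₑ ^ 2 := by
    intro ℓ s
    rw [enorm_mul, mul_pow]
    congr 2
    rw [← ofReal_norm, ← ofReal_norm, RCLike.norm_conj]
  have step : ∀ m : ℤ × ℤ, ∑' n : ℤ × ℤ, ‖∫ s : ℝ × ℝ, Complex.exp (2 * Real.pi * Complex.I *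
        ((n.1 / T * Real.exp (-s.2) - n.2 / T * Real.exp (-s.2) * s.1 : ℝ) : ℂ)) *
        (f s * starRingEnd ℂ (u (s - ((m.1 : ℝ) * δ, (m.2 : ℝ) * δ))))‖ₑ ^ 2
      = ENNReal.ofReal T * (ENNReal.ofReal T *
        ∫⁻ t, ‖u t‖ₑ ^ 2 * (fun s : ℝ × ℝ => ‖f s‖ₑ ^ 2 *
          ENNReal.ofReal (Real.exp s.2) ^ 2) (t + ((m.1 : ℝ) * δ, (m.2 : ℝ) * δ))) := by
    intro m
    generalize ((m.1 : ℝ) * δ, (m.2 : ℝ) * δ) = ℓ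
    rw [parseval_two R T hR hT (fun s => f s * starRingEnd ℂ (u (s - ℓ))) (hmeas ℓ)]
    · congr 2
      rw [← lintegral_add_right_eq_self _ ℓ]
      congr 1
      ext t
      rw [hen, add_sub_cancel_right]
      ring
    · intro s h0
      exact hs s (left_ne_zero_of_mul h0)
    · simp only [hen]
      calc ∫⁻ s, ‖f s‖ₑ ^ 2 * ‖u (s - ℓ)‖ₑ ^ 2 ≤ ∫⁻ s, (C : ENNReal) ^ 2 * ‖u (s - ℓ)‖ₑ ^ 2 := by
            apply lintegral_mono
            intro s
            dsimp only
            gcongr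
            exact hC s
        _ = (C : ENNReal) ^ 2 * ∫⁻ t, ‖u t‖ₑ ^ 2 := by
            rw [lintegral_const_mul _ (by fun_prop),
              lintegral_sub_right_eq_self (fun t => ‖u t‖ₑ ^ 2) ℓ]
        _ < ⊤ := ENNReal.mul_lt_top (ENNReal.pow_lt_top ENNReal.coe_lt_top) hfin
  simp only [step]
  rw [ENNReal.tsum_mul_left, ENNReal.tsum_mul_left, ← lintegral_tsum]
  · simp only [ENNReal.tsum_mul_left]
  · intro m
    exact Measurable.aemeasurable (by fun_prop)

theorem stmt_17 (f : ℝ × ℝ → ℂ) (hf_cont : Continuous f) (hf_supp : HasCompactSupport f)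
    (hf_ne : f ≠ 0) :
    ∃ (Λ M : Set (ℝ × ℝ)) (A B : ℝ), Λ.Countable ∧ M.Countable ∧ 0 < A ∧ A ≤ B ∧
      ∃ g : Λ × M → Lp ℂ 2 (volume : Measure (ℝ × ℝ)),
        (∀ p : Λ × M, ⇑(g p) =ᵐ[(volume : Measure (ℝ × ℝ))] fun t : ℝ × ℝ =>
          Complex.exp (2 * Real.pi * Complex.I *
              ((((p.2 : ℝ × ℝ).1 * Real.exp (-(t.2 + (p.1 : ℝ × ℝ).2)) -
                 (p.2 : ℝ × ℝ).2 * Real.exp (-(t.2 + (p.1 : ℝ × ℝ).2)) *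
                   (t.1 + (p.1 : ℝ × ℝ).1) : ℝ)) : ℂ)) *
            f (t.1 + (p.1 : ℝ × ℝ).1, t.2 + (p.1 : ℝ × ℝ).2)) ∧
        ∀ u : Lp ℂ 2 (volume : Measure (ℝ × ℝ)),
          Summable (fun p : Λ × M => ‖@inner ℂ _ _ u (g p)‖ ^ 2) ∧
          A * ‖u‖ ^ 2 ≤ ∑' p : Λ × M, ‖@inner ℂ _ _ u (g p)‖ ^ 2 ∧
          (∑' p : Λ × M, ‖@inner ℂ _ _ u (g p)‖ ^ 2) ≤ B * ‖u‖ ^ 2 := by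
  -- support radius
  obtain ⟨R, hR, hs⟩ : ∃ R : ℝ, 0 < R ∧ ∀ s, f s ≠ 0 → |s.1| ≤ R ∧ |s.2| ≤ R := by
    obtain ⟨R, hR⟩ := hf_supp.isCompact.isBounded.exists_norm_le
    refine ⟨max R 1, by positivity, fun s h0 => ?_⟩
    have h1 := (hR s (subset_tsupport f h0)).trans (le_max_left R 1)
    exact ⟨(norm_fst_le s).trans h1, (norm_snd_le s).trans h1⟩
  -- sup bounds
  obtain ⟨C₀, hC₀⟩ := hf_cont.bounded_above_of_compact_support hf_supp
  have hC : ∀ s, ‖f s‖ₑ ≤ (C₀.toNNReal : ENNReal) := by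
    intro s
    rw [← ofReal_norm]
    exact ENNReal.ofReal_le_ofReal (hC₀ s)
  set F : ℝ × ℝ → ENNReal := fun s => ‖f s‖ₑ ^ 2 * ENNReal.ofReal (Real.exp s.2) ^ 2 with hF
  set D : NNReal := C₀.toNNReal ^ 2 * (Real.exp R).toNNReal ^ 2 with hD
  have hFC : ∀ s, F s ≤ (D : ENNReal) := by
    intro s
    by_cases h0 : f s = 0
    · simp [hF, h0]
    · have h2 : Real.exp s.2 ≤ Real.exp R :=
        Real.exp_le_exp.mpr ((le_abs_self _).trans (hs s h0).2)
      rw [hD]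
      push_cast
      exact mul_le_mul' (pow_le_pow_left' (hC s) 2)
        (pow_le_pow_left' (ENNReal.ofReal_le_ofReal h2) 2)
  have hFs : ∀ s, F s ≠ 0 → |s.1| ≤ R ∧ |s.2| ≤ R := by
    intro s h0
    apply hs
    intro h1
    simp [hF, h1] at h0
  -- lower bound near a point
  obtain ⟨a, ha⟩ : ∃ a, f a ≠ 0 := by
    by_contra h
    push Not at h
    exact hf_ne (funext h)
  obtain ⟨c, δ, hc, hδ, hlow⟩ : ∃ c δ : ℝ, 0 < c ∧ 0 < δ ∧
      ∀ s : ℝ × ℝ, |s.1 - a.1| ≤ δ → |s.2 - a.2| ≤ δ → ENNReal.ofReal c ≤ F s := by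
    set F0 : ℝ × ℝ → ℝ := fun s => ‖f s‖ ^ 2 * Real.exp s.2 ^ 2 with hF0
    have hcont : Continuous F0 := by fun_prop
    have hpos : 0 < F0 a := by
      have := norm_pos_iff.mpr ha
      positivity
    have hev : ∀ᶠ s in nhds a, F0 a / 2 < F0 s :=
      hcont.continuousAt.eventually (lt_mem_nhds (by linarith))
    obtain ⟨ε, hε, hball⟩ := Metric.eventually_nhds_iff.mp hev
    refine ⟨F0 a / 2, ε / 2, by positivity, by positivity, fun s h1 h2 => ?_⟩
    have h3 := hball (y := s) (by
      rw [Prod.dist_eq, Real.dist_eq, Real.dist_eq]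
      exact max_lt (by linarith) (by linarith))
    have h4 : F s = ENNReal.ofReal (F0 s) := by
      simp only [hF, hF0]
      rw [ENNReal.ofReal_mul (by positivity), ENNReal.ofReal_pow (norm_nonneg _), ofReal_norm,
        ENNReal.ofReal_pow (Real.exp_pos _).le]
    rw [h4]
    exact ENNReal.ofReal_le_ofReal h3.le
  obtain ⟨N, hN⟩ := periodize F δ R hδ D (ENNReal.ofReal c) hFC hFs a hlow
  obtain ⟨T, hT⟩ : ∃ T : ℝ, T / 2 = Real.exp R * (R + 1) := ⟨2 * (Real.exp R * (R + 1)), by ring⟩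
  have hTpos : 0 < T := by
    have : 0 < Real.exp R * (R + 1) := by positivity
    linarith
  set lat : ℤ × ℤ → ℝ × ℝ := fun m => ((m.1 : ℝ) * δ, (m.2 : ℝ) * δ) with hlat
  set frq : ℤ × ℤ → ℝ × ℝ := fun n => ((n.1 : ℝ) / T, (n.2 : ℝ) / T) with hfrq
  have hlat_inj : Function.Injective lat := by
    intro m m' h
    simp only [hlat, Prod.mk.injEq] at h
    have h1 := mul_right_cancel₀ hδ.ne' h.1
    have h2 := mul_right_cancel₀ hδ.ne' h.2
    exact Prod.ext (by exact_mod_cast h1) (by exact_mod_cast h2)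
  have hfrq_inj : Function.Injective frq := by
    intro m m' h
    simp only [hfrq, Prod.mk.injEq] at h
    have h1 := (div_left_inj' hTpos.ne').mp h.1
    have h2 := (div_left_inj' hTpos.ne').mp h.2
    exact Prod.ext (by exact_mod_cast h1) (by exact_mod_cast h2)
  -- the functions
  set E : ℝ × ℝ → ℝ × ℝ → ℂ := fun v s => Complex.exp (2 * Real.pi * Complex.I *
    ((v.1 * Real.exp (-s.2) - v.2 * Real.exp (-s.2) * s.1 : ℝ) : ℂ)) * f s with hE
  have hmem : ∀ ℓ v : ℝ × ℝ, MemLp (fun t => E v (t + ℓ)) 2 (volume : Measure (ℝ × ℝ)) := by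
    intro ℓ v
    have h1 : Continuous (E v) := by
      simp only [hE]
      fun_prop
    have h2 : HasCompactSupport (E v) := hf_supp.mul_left
    have h3 : MemLp (E v) 2 (volume : Measure (ℝ × ℝ)) := h1.memLp_of_hasCompactSupport h2
    exact h3.comp_measurePreserving (measurePreserving_add_right volume ℓ)
  set g : (Set.range lat) × (Set.range frq) → Lp ℂ 2 (volume : Measure (ℝ × ℝ)) :=
    fun p => (hmem p.1 p.2).toLp with hg
  set A : ℝ := T * (T * c) with hA
  set B : ℝ := T * (T * (N * D)) with hB
  have hApos : 0 < A := by positivity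
  have hBnn : 0 ≤ B := by positivity
  refine ⟨Set.range lat, Set.range frq, A, max A B, Set.countable_range _, Set.countable_range _,
    hApos, le_max_left _ _, g, fun p => (hmem p.1 p.2).coeFn_toLp, fun u => ?_⟩
  have hum : Measurable u := (Lp.stronglyMeasurable u).measurable
  have hnorm : ∫⁻ t, ‖u t‖ₑ ^ 2 = ENNReal.ofReal (‖u‖ ^ 2) := by
    rw [ENNReal.ofReal_pow (norm_nonneg _), ofReal_norm, Lp.enorm_def,
      eLpNorm_eq_lintegral_rpow_enorm_toReal (by norm_num) (by norm_num), ← ENNReal.rpow_natCast,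
      ← ENNReal.rpow_mul]
    simp
  have hinner : ∀ ℓ v : ℝ × ℝ, @inner ℂ _ _ u ((hmem ℓ v).toLp) =
      ∫ s : ℝ × ℝ, Complex.exp (2 * Real.pi * Complex.I *
        ((v.1 * Real.exp (-s.2) - v.2 * Real.exp (-s.2) * s.1 : ℝ) : ℂ)) *
        (f s * starRingEnd ℂ (u (s - ℓ))) := by
    intro ℓ v
    rw [L2.inner_def, ← integral_add_right_eq_self (fun s : ℝ × ℝ => Complex.exp (2 * Real.pi *
      Complex.I * ((v.1 * Real.exp (-s.2) - v.2 * Real.exp (-s.2) * s.1 : ℝ) : ℂ)) *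
        (f s * starRingEnd ℂ (u (s - ℓ)))) ℓ]
    apply integral_congr_ae
    filter_upwards [(hmem ℓ v).coeFn_toLp] with t ht
    rw [ht, RCLike.inner_apply, add_sub_cancel_right, ← mul_assoc]
  have htot : ∑' p, ‖@inner ℂ _ _ u (g p)‖ₑ ^ 2 = ENNReal.ofReal T * (ENNReal.ofReal T *
        ∫⁻ t, ‖u t‖ₑ ^ 2 * ∑' m : ℤ × ℤ, F (t + lat m)) := by
    rw [← frame_sum R T δ hR hT f hf_cont.measurable hs _ hC u hum
      (by rw [hnorm]; exact ENNReal.ofReal_lt_top), ENNReal.tsum_prod']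
    simp only [hg, hinner]
    rw [tsum_range (f := fun ℓ : ℝ × ℝ => ∑' b : Set.range frq, ‖∫ s : ℝ × ℝ,
      Complex.exp (2 * Real.pi * Complex.I *
        (((b : ℝ × ℝ).1 * Real.exp (-s.2) - (b : ℝ × ℝ).2 * Real.exp (-s.2) * s.1 : ℝ) : ℂ)) *
        (f s * starRingEnd ℂ (u (s - ℓ)))‖ₑ ^ 2) hlat_inj]
    congr 1
    ext m
    rw [tsum_range (f := fun v : ℝ × ℝ => ‖∫ s : ℝ × ℝ,
      Complex.exp (2 * Real.pi * Complex.I *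
        ((v.1 * Real.exp (-s.2) - v.2 * Real.exp (-s.2) * s.1 : ℝ) : ℂ)) *
        (f s * starRingEnd ℂ (u (s - lat m)))‖ₑ ^ 2) hfrq_inj]
  apply summable_of_enn _ _ _ _ (by positivity) hApos.le (hBnn.trans (le_max_right _ _))
  · rw [htot, ← hnorm, hA, ENNReal.ofReal_mul hTpos.le, ENNReal.ofReal_mul hTpos.le, mul_assoc,
      mul_assoc, ← lintegral_const_mul _ (by fun_prop)]
    refine mul_le_mul' le_rfl (mul_le_mul' le_rfl (lintegral_mono fun t => ?_))
    rw [mul_comm]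
    exact mul_le_mul' le_rfl (hN t).1
  · refine le_trans ?_ (mul_le_mul_left (ENNReal.ofReal_le_ofReal (le_max_right A B)) _)
    rw [htot, ← hnorm, hB, ENNReal.ofReal_mul hTpos.le, ENNReal.ofReal_mul hTpos.le, mul_assoc,
      mul_assoc, ← lintegral_const_mul (ENNReal.ofReal (N * D)) (by fun_prop)]
    refine mul_le_mul' le_rfl (mul_le_mul' le_rfl (lintegral_mono fun t => ?_))
    dsimp only
    rw [mul_comm]
    refine mul_le_mul' ?_ le_rfl
    refine (hN t).2.trans (le_of_eq ?_)
    rw [ENNReal.ofReal_mul (by positivity)]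
    simp
end

section
/- Let r ≥ 1, let O ⊆ ℝʳ be a bounded open neighborhood of 0, and let Θ : O → ℝʳ be an injective C¹ map with det DΘ(h) ≠ 0 for every h ∈ O and with Θ(O) bounded. For every continuous function f : ℝʳ → ℂ, not identically zero, with compact support contained in O, there exist a countable set Λ ⊆ ℝʳ and a real number ς > 0 with Θ(O) ⊆ [-ς, ς)ʳ, together with constants 0 < A ≤ B < ∞, such that the family g_{ℓ,k}(h) = exp( 2πi ⟨Θ(ℓ + h), k⟩ / (2ς) ) · f(ℓ + h) (set to 0 when ℓ + h ∉ O), indexed by (ℓ, k) ∈ Λ × ℤʳ, is a frame for L²(ℝʳ) with frame bounds A and B. -/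
open MeasureTheory Set
open scoped ENNReal

noncomputable local instance instMSCircle18 : MeasureSpace UnitAddCircle := ⟨AddCircle.haarAddCircle⟩

lemma aux_mFourier {r : ℕ} (k : Fin r → ℤ) (y : Fin r → ℝ) :
    UnitAddTorus.mFourier k (fun i => (y i : UnitAddCircle)) =
      Complex.exp (2 * Real.pi * Complex.I * ((∑ j, y j * (k j : ℝ) : ℝ) : ℂ)) := by
  simp only [UnitAddTorus.mFourier, ContinuousMap.coe_mk, fourier_coe_apply]
  rw [← Complex.exp_sum]
  congr 1
  push_cast
  rw [Finset.mul_sum]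
  refine Finset.sum_congr rfl fun j _ => ?_
  ring

lemma aux_box {r : ℕ} : MeasurableSet {x : Fin r → ℝ | ∀ i, x i ∈ Ioc ((fun _ => -(1/2) : Fin r → ℝ) i) ((fun _ => -(1/2) : Fin r → ℝ) i + 1)} :=
  MeasurableSet.univ_pi' (fun _ => measurableSet_Ioc)

lemma aux_parseval_s18 {r : ℕ} (G : (Fin r → ℝ) → ℂ)
    (hG : MemLp G 2 (volume.restrict {x : Fin r → ℝ | ∀ i, x i ∈ Ioc ((fun _ => -(1/2) : Fin r → ℝ) i) ((fun _ => -(1/2) : Fin r → ℝ) i + 1)})) :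
    ∑' k : Fin r → ℤ, ‖∫ y in {x : Fin r → ℝ | ∀ i, x i ∈ Ioc ((fun _ => -(1/2) : Fin r → ℝ) i) ((fun _ => -(1/2) : Fin r → ℝ) i + 1)},
      Complex.exp (2 * Real.pi * Complex.I * ((∑ j, y j * (k j : ℝ) : ℝ) : ℂ)) * G y‖ₑ ^ 2
    = ∫⁻ y in {x : Fin r → ℝ | ∀ i, x i ∈ Ioc ((fun _ => -(1/2) : Fin r → ℝ) i) ((fun _ => -(1/2) : Fin r → ℝ) i + 1)}, ‖G y‖ₑ ^ 2 := by
  set a : Fin r → ℝ := fun _ => -(1/2) with ha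
  set S := {x : Fin r → ℝ | ∀ i, x i ∈ Ioc (a i) (a i + 1)} with hS
  have hSm : MeasurableSet S := MeasurableSet.univ_pi' (fun _ => measurableSet_Ioc)
  let H : UnitAddTorus (Fin r) → ℂ := fun t => G (UnitAddTorus.measurableEquivPiIoc a t).1
  have hmp : MeasurePreserving (fun t : UnitAddTorus (Fin r) => (UnitAddTorus.measurableEquivPiIoc a t).1)
      volume (volume.restrict S) := 
    (measurePreserving_subtype_coe hSm).comp (UnitAddTorus.measurePreserving_equivPiIoc a)
  have hH : MemLp H 2 volume := hG.comp_measurePreserving hmp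
  have hHv : ∀ x ∈ S, H (fun i => (x i : UnitAddCircle)) = G x := by
    intro x hx
    change G _ = G x
    congr 1
    have := (UnitAddTorus.measurableEquivPiIoc a).apply_symm_apply ⟨x, hx⟩
    exact congrArg Subtype.val this
  have key := UnitAddTorus.hasSum_sq_mFourierCoeff hH.toLp
  have hc : ∀ k, UnitAddTorus.mFourierCoeff hH.toLp (-k) = ∫ y in S,
      Complex.exp (2 * Real.pi * Complex.I * ((∑ j, y j * (k j : ℝ) : ℝ) : ℂ)) * G y := by
    intro k
    have : UnitAddTorus.mFourierCoeff hH.toLp (-k) = UnitAddTorus.mFourierCoeff H (-k) := by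
      unfold UnitAddTorus.mFourierCoeff
      refine integral_congr_ae ?_
      filter_upwards [hH.coeFn_toLp] with t ht
      rw [ht]
    rw [this, UnitAddTorus.mFourierCoeff_eq_integral _ _ a]
    refine setIntegral_congr_fun hSm fun x hx => ?_
    simp only [neg_neg]
    rw [hHv x hx, aux_mFourier, smul_eq_mul]
  have hI : ENNReal.ofReal (∫ t, ‖(MemLp.toLp H hH) t‖ ^ 2) = ∫⁻ y in S, ‖G y‖ₑ ^ 2 := by
    have h1 : ∫ t, ‖(MemLp.toLp H hH) t‖ ^ 2 = ∫ t, ‖H t‖ ^ 2 := by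
      refine integral_congr_ae ?_
      filter_upwards [hH.coeFn_toLp] with t ht
      rw [ht]
    rw [h1, ofReal_integral_eq_lintegral_ofReal hH.norm.integrable_sq (by filter_upwards with t using sq_nonneg _)]
    rw [UnitAddTorus.lintegral_preimage _ a]
    refine setLIntegral_congr_fun hSm fun x hx => ?_
    rw [hHv x hx, ENNReal.ofReal_pow (norm_nonneg _), ofReal_norm]
  rw [← hI, ← key.tsum_eq, ENNReal.ofReal_tsum_of_nonneg (fun _ => sq_nonneg _) key.summable,
    ← (Equiv.neg (Fin r → ℤ)).tsum_eq]
  refine tsum_congr fun k => ?_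
  rw [← hc, ENNReal.ofReal_pow (norm_nonneg _), ofReal_norm]
  simp

lemma aux_cv {r : ℕ} (O : Set (Fin r → ℝ)) (hO : MeasurableSet O)
    (T : (Fin r → ℝ) → (Fin r → ℝ)) (T' : (Fin r → ℝ) → (Fin r → ℝ) →L[ℝ] (Fin r → ℝ))
    (hT' : ∀ x ∈ O, HasFDerivWithinAt T (T' x) O x) (hinj : InjOn T O)
    (hbox : T '' O ⊆ {x : Fin r → ℝ | ∀ i, x i ∈ Ioc ((fun _ => -(1/2) : Fin r → ℝ) i) ((fun _ => -(1/2) : Fin r → ℝ) i + 1)})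
    (hdet : ∀ x ∈ O, (T' x).det ≠ 0) (φ : (Fin r → ℝ) → ℂ) (hφ : IntegrableOn φ O)
    (hfin : ∫⁻ x in O, ENNReal.ofReal (|(T' x).det|⁻¹) * ‖φ x‖ₑ ^ 2 ≠ ⊤) :
    ∑' k : Fin r → ℤ, ‖∫ x in O,
      Complex.exp (2 * Real.pi * Complex.I * ((∑ j, T x j * (k j : ℝ) : ℝ) : ℂ)) * φ x‖ₑ ^ 2
    = ∫⁻ x in O, ENNReal.ofReal (|(T' x).det|⁻¹) * ‖φ x‖ₑ ^ 2 := by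
  set S := {x : Fin r → ℝ | ∀ i, x i ∈ Ioc ((fun _ => -(1/2) : Fin r → ℝ) i) ((fun _ => -(1/2) : Fin r → ℝ) i + 1)} with hS
  have hSm : MeasurableSet S := aux_box
  have hTO : MeasurableSet (T '' O) := measurable_image_of_fderivWithin hO hT' hinj
  let inv := Function.invFunOn T O
  have hinv : ∀ x ∈ O, inv (T x) = x := fun x hx => hinj.leftInvOn_invFunOn hx
  let G0 : (Fin r → ℝ) → ℂ := fun y => (|(T' (inv y)).det|⁻¹ : ℝ) • φ (inv y)
  have hG0 : ∀ x ∈ O, |(T' x).det| • G0 (T x) = φ x := by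
    intro x hx
    simp only [G0]
    rw [hinv x hx, smul_smul, mul_inv_cancel₀ (abs_ne_zero.2 (hdet x hx)), one_smul]
  let G := indicator (T '' O) G0
  have hG0int : IntegrableOn G0 (T '' O) := by
    rw [integrableOn_image_iff_integrableOn_abs_det_fderiv_smul volume hO hT' hinj]
    exact hφ.congr_fun (fun x hx => (hG0 x hx).symm) hO
  have hrest : (volume.restrict S).restrict (T '' O) = volume.restrict (T '' O) :=
    Measure.restrict_restrict_of_subset hbox
  have hI2 : ∫⁻ y in S, ‖G y‖ₑ ^ 2 = ∫⁻ x in O, ENNReal.ofReal (|(T' x).det|⁻¹) * ‖φ x‖ₑ ^ 2 := by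
    have : (fun y => ‖G y‖ₑ ^ 2) = indicator (T '' O) (fun y => ‖G0 y‖ₑ ^ 2) := by
      ext y
      by_cases hy : y ∈ T '' O <;> simp [G, hy]
    rw [this, lintegral_indicator hTO, hrest,
      lintegral_image_eq_lintegral_abs_det_fderiv_mul volume hO hT' hinj]
    refine setLIntegral_congr_fun hO fun x hx => ?_
    have hd := abs_pos.2 (hdet x hx)
    simp only [G0]
    rw [hinv x hx, enorm_smul, mul_pow, ← mul_assoc]
    congr 1
    rw [Real.enorm_eq_ofReal (by positivity), ← ENNReal.ofReal_pow (by positivity),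
      ← ENNReal.ofReal_mul (by positivity)]
    congr 1
    field_simp
  have hGm : AEStronglyMeasurable G (volume.restrict S) := by
    refine (aestronglyMeasurable_indicator_iff hTO).2 ?_
    rw [hrest]
    exact hG0int.aestronglyMeasurable
  have hGL : MemLp G 2 (volume.restrict S) := by
    refine ⟨hGm, ?_⟩
    rw [eLpNorm_lt_top_iff_lintegral_rpow_enorm_lt_top (by simp) (by simp)]
    have : (∫⁻ y in S, ‖G y‖ₑ ^ 2) < ⊤ := by rw [hI2]; exact hfin.lt_top
    simpa using this
  rw [← hI2, ← aux_parseval_s18 G hGL]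
  refine tsum_congr fun k => ?_
  congr 2
  have : (fun y : Fin r → ℝ => Complex.exp (2 * Real.pi * Complex.I * ((∑ j, y j * (k j : ℝ) : ℝ) : ℂ)) * G y)
      = indicator (T '' O) (fun y => Complex.exp (2 * Real.pi * Complex.I * ((∑ j, y j * (k j : ℝ) : ℝ) : ℂ)) * G0 y) := by
    ext y
    by_cases hy : y ∈ T '' O <;> simp [G, hy]
  rw [this, integral_indicator hTO, hrest,
    integral_image_eq_integral_abs_det_fderiv_smul volume hO hT' hinj]
  refine setIntegral_congr_fun hO fun x hx => ?_
  rw [← hG0 x hx, mul_smul_comm]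

/-- Lattice sum bounds. -/
lemma aux_lattice {r : ℕ} (W : (Fin r → ℝ) → ℝ≥0∞) (M c : ℝ≥0∞) (x₀ : Fin r → ℝ) (ε R : ℝ) (hε : 0 < ε)
    (hM : ∀ x, W x ≤ M) (hR : ∀ x, W x ≠ 0 → ∀ j, |x j| ≤ R)
    (hc : ∀ x, (∀ j, |x j - x₀ j| < ε) → c ≤ W x) :
    ∃ N : ℕ, ∀ h : Fin r → ℝ, c ≤ ∑' n : Fin r → ℤ, W ((fun j => ε * (n j : ℝ)) + h) ∧
      ∑' n : Fin r → ℤ, W ((fun j => ε * (n j : ℝ)) + h) ≤ N * M := by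
  obtain ⟨K, hK⟩ := exists_nat_gt (R / ε + 1)
  let s : Finset (Fin r → ℤ) := Fintype.piFinset fun _ => Finset.Icc (-(K : ℤ)) K
  refine ⟨s.card, fun h => ⟨?_, ?_⟩⟩
  · let n : Fin r → ℤ := fun j => ⌊(x₀ j - h j) / ε⌋
    refine le_trans (hc _ fun j => ?_) (ENNReal.le_tsum n)
    simp only [n, Pi.add_apply]
    have h1 := Int.floor_le ((x₀ j - h j) / ε)
    have h2 := Int.lt_floor_add_one ((x₀ j - h j) / ε)
    rw [le_div_iff₀ hε] at h1
    rw [div_lt_iff₀ hε] at h2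
    rw [abs_lt]
    constructor <;> nlinarith
  · let m : Fin r → ℤ := fun j => ⌊(- h j) / ε⌋
    rw [← (Equiv.addRight m).tsum_eq]
    rw [tsum_eq_sum (s := s)]
    · calc _ ≤ ∑ b ∈ s, M := Finset.sum_le_sum fun _ _ => hM _
        _ = _ := by simp
    · intro n hn
      by_contra hne
      apply hn
      rw [Fintype.mem_piFinset]
      intro j
      have := hR _ hne j
      simp only [Equiv.coe_addRight, Pi.add_apply, m] at this
      have h1 := Int.floor_le ((- h j) / ε)
      have h2 := Int.lt_floor_add_one ((- h j) / ε)
      rw [le_div_iff₀ hε] at h1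
      rw [div_lt_iff₀ hε] at h2
      have hK' : R < ε * (K - 1) := by
        have : R / ε < K - 1 := by linarith
        rw [div_lt_iff₀ hε] at this
        linarith
      push_cast at this
      rw [abs_le] at this
      rw [Finset.mem_Icc]
      constructor
      · have : (-(K:ℝ)) ≤ n j := by
          by_contra hcon
          push Not at hcon
          nlinarith
        exact_mod_cast this
      · have : (n j : ℝ) ≤ K := by
          by_contra hcon
          push Not at hcon
          nlinarith
        exact_mod_cast this

/-- (Theorem 1.1 of the paper, realized in coordinates when the conormal
group `H` is `ℝʳ`.)  Let `O ⊆ ℝʳ` be a bounded open neighborhood of `0` and `Θ : O → ℝʳ` an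
injective `C¹` map with everywhere nonvanishing Jacobian determinant and bounded image.
Then for every continuous, not identically zero function `f` with compact support contained
in `O`, there exist a countable set `Λ ⊆ ℝʳ`, a real `ς > 0` with `Θ(O) ⊆ [-ς, ς)ʳ` and
constants `0 < A ≤ B < ∞` such that the family
`g_{ℓ,k}(h) = exp(2πi⟨Θ(ℓ+h), k⟩/(2ς)) f(ℓ+h)` (zero when `ℓ + h ∉ O`), indexed by
`(ℓ, k) ∈ Λ × ℤʳ`, is a frame for `L²(ℝʳ)` with frame bounds `A` and `B`. -/
theorem stmt_18 (r : ℕ) (hr : 0 < r)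
    (O : Set (Fin r → ℝ)) (hO_open : IsOpen O) (hO_bdd : Bornology.IsBounded O)
    (hO_zero : (0 : Fin r → ℝ) ∈ O)
    (Θ : (Fin r → ℝ) → (Fin r → ℝ)) (hΘ_inj : Set.InjOn Θ O)
    (hΘ_C1 : ContDiffOn ℝ 1 Θ O)
    (hΘ_det : ∀ h ∈ O, (fderivWithin ℝ Θ O h).det ≠ 0)
    (hΘO_bdd : Bornology.IsBounded (Θ '' O))
    (f : (Fin r → ℝ) → ℂ) (hf_cont : Continuous f) (hf_supp : HasCompactSupport f)
    (hf_suppO : tsupport f ⊆ O) (hf_ne : f ≠ 0) :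
    ∃ (Λ : Set (Fin r → ℝ)) (ς A B : ℝ), Λ.Countable ∧ 0 < ς ∧
      Θ '' O ⊆ (Set.univ.pi fun _ : Fin r => Set.Ico (-ς) ς) ∧ 0 < A ∧ A ≤ B ∧
      ∃ g : Λ × (Fin r → ℤ) → Lp ℂ 2 (volume : Measure (Fin r → ℝ)),
        (∀ p : Λ × (Fin r → ℤ), ⇑(g p) =ᵐ[(volume : Measure (Fin r → ℝ))]
          fun h : Fin r → ℝ => Set.indicator O
            (fun x => Complex.exp (2 * Real.pi * Complex.I *
                (↑(∑ j, Θ x j * ((p.2 j : ℤ) : ℝ)) : ℂ) / (↑(2 * ς) : ℂ)) * f x)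
            (↑p.1 + h)) ∧
        ∀ u : Lp ℂ 2 (volume : Measure (Fin r → ℝ)),
          Summable (fun p : Λ × (Fin r → ℤ) => ‖@inner ℂ _ _ u (g p)‖ ^ 2) ∧
          A * ‖u‖ ^ 2 ≤ ∑' p : Λ × (Fin r → ℤ), ‖@inner ℂ _ _ u (g p)‖ ^ 2 ∧
          (∑' p : Λ × (Fin r → ℤ), ‖@inner ℂ _ _ u (g p)‖ ^ 2) ≤ B * ‖u‖ ^ 2 := by
  classical
  -- the scale
  obtain ⟨C, hC⟩ := hΘO_bdd.exists_norm_le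
  set ς : ℝ := |C| + 1 with hς
  have hς0 : 0 < ς := by positivity
  have hΘlt : ∀ x ∈ O, ∀ j, |Θ x j| < ς := by
    intro x hx j
    have h1 := hC _ (mem_image_of_mem Θ hx)
    have h2 := norm_le_pi_norm (Θ x) j
    rw [Real.norm_eq_abs] at h2
    have h3 := le_abs_self C
    linarith
  -- rescaled map
  let T : (Fin r → ℝ) → (Fin r → ℝ) := fun x => (2 * ς)⁻¹ • Θ x
  let T' : (Fin r → ℝ) → (Fin r → ℝ) →L[ℝ] (Fin r → ℝ) := fun x => (2 * ς)⁻¹ • fderivWithin ℝ Θ O x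
  have hOm : MeasurableSet O := hO_open.measurableSet
  have hT' : ∀ x ∈ O, HasFDerivWithinAt T (T' x) O x := fun x hx =>
    ((hΘ_C1.differentiableOn one_ne_zero x hx).hasFDerivWithinAt).const_smul ((2 * ς)⁻¹)
  have hTinj : InjOn T O := by
    intro x hx y hy hxy
    exact hΘ_inj hx hy (smul_right_injective _ (by positivity : (2 * ς)⁻¹ ≠ 0) hxy)
  have hbox : T '' O ⊆ {x : Fin r → ℝ | ∀ i, x i ∈ Ioc ((fun _ => -(1/2) : Fin r → ℝ) i) ((fun _ => -(1/2) : Fin r → ℝ) i + 1)} := by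
    rintro _ ⟨x, hx, rfl⟩ j
    have h1 := abs_lt.1 (hΘlt x hx j)
    have h2 : T x j = Θ x j / (2 * ς) := by simp [T, div_eq_inv_mul]
    simp only [mem_Ioc]
    rw [h2, lt_div_iff₀ (by positivity), div_le_iff₀ (by positivity)]
    constructor <;> nlinarith
  have hdet : ∀ x ∈ O, (T' x).det ≠ 0 := by
    intro x hx
    have : (T' x).det = ((2 * ς)⁻¹) ^ r * (fderivWithin ℝ Θ O x).det := by
      simp only [T', ContinuousLinearMap.det, ContinuousLinearMap.toLinearMap_smul, LinearMap.det_smul]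
      simp
    rw [this]
    exact mul_ne_zero (by positivity) (hΘ_det x hx)
  have hT'c : ContinuousOn T' O :=
    (hΘ_C1.continuousOn_fderivWithin hO_open.uniqueDiffOn le_rfl).const_smul ((2 * ς)⁻¹)
  have hdetc : ContinuousOn (fun x => (T' x).det) O :=
    ContinuousLinearMap.continuous_det.comp_continuousOn hT'c
  -- the weight
  let w : (Fin r → ℝ) → ℝ := fun x => |(T' x).det|⁻¹ * ‖f x‖ ^ 2
  have hwc : ContinuousOn w O :=
    (hdetc.abs.inv₀ fun x hx => abs_ne_zero.2 (hdet x hx)).mul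
      ((hf_cont.norm.pow 2).continuousOn)
  have hw0 : ∀ x, 0 ≤ w x := fun x => by positivity
  let W : (Fin r → ℝ) → ℝ≥0∞ := indicator O fun x => ENNReal.ofReal (w x)
  have hWm : Measurable W := by
    have : W = fun x => ENNReal.ofReal (O.piecewise w 0 x) := by
      ext x
      by_cases hx : x ∈ O <;> simp [W, hx]
    rw [this]
    exact (hwc.measurable_piecewise continuousOn_const hOm).ennreal_ofReal
  obtain ⟨M, hM0, hM⟩ : ∃ M : ℝ, 0 ≤ M ∧ ∀ x, W x ≤ ENNReal.ofReal M := by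
    obtain ⟨M, hM⟩ := hf_supp.isCompact.exists_bound_of_continuousOn (hwc.mono hf_suppO)
    refine ⟨|M|, abs_nonneg _, fun x => ?_⟩
    by_cases hx : x ∈ tsupport f
    · simp only [W, indicator_of_mem (hf_suppO hx)]
      refine ENNReal.ofReal_le_ofReal ?_
      exact (le_abs_self _).trans ((hM x hx).trans (le_abs_self _))
    · have : w x = 0 := by simp [w, image_eq_zero_of_notMem_tsupport hx]
      by_cases hxO : x ∈ O <;> simp [W, this, hxO]
  obtain ⟨x₀, hx₀⟩ : ∃ x₀, f x₀ ≠ 0 := by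
    by_contra hcon
    push Not at hcon
    exact hf_ne (funext hcon)
  have hx₀O : x₀ ∈ O := hf_suppO (subset_tsupport f hx₀)
  have hwx₀ : 0 < w x₀ := by
    have h1 := abs_pos.2 (hdet x₀ hx₀O)
    have h2 := norm_pos_iff.2 hx₀
    simp only [w]
    positivity
  set c : ℝ := w x₀ / 2 with hc
  have hc0 : 0 < c := by positivity
  obtain ⟨ε, hε, hcε⟩ : ∃ ε > 0, ∀ x : Fin r → ℝ, (∀ j, |x j - x₀ j| < ε) → ENNReal.ofReal c ≤ W x := by
    have h1 : ∀ᶠ x in nhds x₀, c < w x :=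
      (hwc.continuousAt (hO_open.mem_nhds hx₀O)).eventually (lt_mem_nhds (by simp only [hc]; linarith))
    obtain ⟨ε, hε, h2⟩ := Metric.eventually_nhds_iff.1 (h1.and (hO_open.mem_nhds hx₀O))
    refine ⟨ε, hε, fun x hx => ?_⟩
    have h3 := h2 ((dist_pi_lt_iff hε).2 fun j => by rw [Real.dist_eq]; exact hx j)
    simp only [W]
    rw [indicator_of_mem h3.2]
    exact ENNReal.ofReal_le_ofReal h3.1.le
  obtain ⟨R, hR⟩ := hO_bdd.exists_norm_le
  obtain ⟨N, hN⟩ := aux_lattice W (ENNReal.ofReal M) (ENNReal.ofReal c) x₀ ε R hε hM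
    (fun x hx j => by
      have hxO : x ∈ O := by
        by_contra hcon
        exact hx (by simp [W, hcon])
      have := norm_le_pi_norm x j
      rw [Real.norm_eq_abs] at this
      exact this.trans (hR x hxO)) hcε
  -- the lattice
  let ι : (Fin r → ℤ) → (Fin r → ℝ) := fun n j => ε * (n j : ℝ)
  have hι : Function.Injective ι := by
    intro n m hnm
    ext j
    have := congrFun hnm j
    simp only [ι] at this
    exact_mod_cast mul_left_cancel₀ hε.ne' this
  let e : (Fin r → ℤ) ≃ range ι := Equiv.ofInjective ι hι
  -- the generating functions
  let E : (Fin r → ℤ) → (Fin r → ℝ) → ℂ := fun k x =>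
    Complex.exp (2 * Real.pi * Complex.I * (↑(∑ j, Θ x j * ((k j : ℤ) : ℝ)) : ℂ) / (↑(2 * ς) : ℂ))
  have hE : ∀ k x, E k x =
      Complex.exp (2 * Real.pi * Complex.I * ((∑ j, T x j * (k j : ℝ) : ℝ) : ℂ)) := by
    intro k x
    simp only [E, T]
    congr 1
    have : (∑ j, ((2 * ς)⁻¹ • Θ x) j * (k j : ℝ)) = (∑ j, Θ x j * (k j : ℝ)) / (2 * ς) := by
      rw [Finset.sum_div]
      refine Finset.sum_congr rfl fun j _ => ?_
      simp only [Pi.smul_apply, smul_eq_mul]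
      ring
    rw [this, Complex.ofReal_div]
    ring
  have hEn : ∀ k x, ‖E k x‖ = 1 := by
    intro k x
    rw [hE, show (2 * Real.pi * Complex.I * ((∑ j, T x j * (k j : ℝ) : ℝ) : ℂ) : ℂ) =
      ((2 * Real.pi * ∑ j, T x j * (k j : ℝ) : ℝ) : ℂ) * Complex.I by push_cast; ring]
    exact Complex.norm_exp_ofReal_mul_I _
  let g0 : (Fin r → ℤ) → (Fin r → ℝ) → ℂ := fun k => indicator O fun x => E k x * f x
  have hΘc : ContinuousOn Θ O := hΘ_C1.continuousOn
  have hEc : ∀ k, ContinuousOn (E k) O := by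
    intro k
    have : ∀ j, ContinuousOn (fun x => Θ x j) O := fun j =>
      (continuous_apply j).comp_continuousOn hΘc
    refine Complex.continuous_exp.comp_continuousOn ?_
    refine ContinuousOn.div_const (ContinuousOn.mul continuousOn_const ?_) _
    refine Complex.continuous_ofReal.comp_continuousOn ?_
    exact continuousOn_finsetSum _ fun j _ => (this j).mul continuousOn_const
  have hfL : MemLp f 2 volume := hf_cont.memLp_of_hasCompactSupport hf_supp
  have hg0 : ∀ k, MemLp (g0 k) 2 volume := by
    intro k
    refine hfL.of_le ?_ (Filter.Eventually.of_forall fun x => ?_)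
    · exact (aestronglyMeasurable_indicator_iff hOm).2
        (((hEc k).mul hf_cont.continuousOn).aestronglyMeasurable hOm)
    · by_cases hx : x ∈ O <;> simp [g0, hx, hEn]
  have hgL : ∀ p : range ι × (Fin r → ℤ), MemLp (fun h => g0 p.2 (↑p.1 + h)) 2 volume :=
    fun p => (hg0 p.2).comp_measurePreserving (measurePreserving_add_left volume (p.1 : Fin r → ℝ))
  have hB0 : 0 ≤ (N : ℝ) * M := by positivity
  refine ⟨range ι, ς, c, c + N * M, countable_range ι, hς0, ?_, hc0, by linarith,
    fun p => (hgL p).toLp _, fun p => (hgL p).coeFn_toLp, fun u => ?_⟩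
  · rintro _ ⟨x, hx, rfl⟩ j _
    have h1 := abs_lt.1 (hΘlt x hx j)
    exact ⟨h1.1.le, h1.2⟩
  -- frame estimates
  have hu : MemLp u 2 volume := Lp.memLp u
  have hun : ∫⁻ h, ‖u h‖ₑ ^ 2 = ENNReal.ofReal (‖u‖ ^ 2) := by
    rw [Lp.norm_def, ← ENNReal.toReal_pow, ENNReal.ofReal_toReal
      (ENNReal.pow_ne_top (Lp.eLpNorm_ne_top u)),
      eLpNorm_eq_lintegral_rpow_enorm_toReal (by simp) (by simp), ← ENNReal.rpow_natCast,
      ← ENNReal.rpow_mul]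
    simp
  have hum : AEMeasurable (fun h => ‖u h‖ₑ ^ 2) volume :=
    hu.aestronglyMeasurable.enorm.pow_const 2
  have hW1 : ∀ ℓ : Fin r → ℝ, ∀ h, ENNReal.ofReal M * ‖u h‖ₑ ^ 2 ≥ W (ℓ + h) * ‖u h‖ₑ ^ 2 :=
    fun ℓ h => mul_le_mul_left (hM _) _
  have hsum : ∀ ℓ : range ι, ∑' k : Fin r → ℤ, ‖@inner ℂ _ _ u ((hgL (ℓ, k)).toLp _)‖ₑ ^ 2 =
      ∫⁻ h, W ((ℓ : Fin r → ℝ) + h) * ‖u h‖ₑ ^ 2 := by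
    intro ℓ
    let φ : (Fin r → ℝ) → ℂ := fun x => f x * (starRingEnd ℂ) (u (-(ℓ : Fin r → ℝ) + x))
    have hul : MemLp (fun x => (starRingEnd ℂ) (u (-(ℓ : Fin r → ℝ) + x))) 2 volume :=
      (hu.comp_measurePreserving (measurePreserving_add_left volume (-(ℓ : Fin r → ℝ)))).star
    have hφ : Integrable φ := hfL.integrable_mul hul
    have hI : ∫⁻ x in O, ENNReal.ofReal (|(T' x).det|⁻¹) * ‖φ x‖ₑ ^ 2 =
        ∫⁻ h, W ((ℓ : Fin r → ℝ) + h) * ‖u h‖ₑ ^ 2 := by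
      have h1 := lintegral_add_left_eq_self (μ := (volume : Measure (Fin r → ℝ)))
        (fun x => W x * ‖u (-(ℓ : Fin r → ℝ) + x)‖ₑ ^ 2) (ℓ : Fin r → ℝ)
      simp only [neg_add_cancel_left] at h1
      rw [h1, ← lintegral_indicator hOm]
      refine lintegral_congr fun x => ?_
      by_cases hx : x ∈ O
      · simp only [indicator_of_mem hx, W, w, φ]
        rw [enorm_mul, mul_pow, ENNReal.ofReal_mul (by positivity),
          ENNReal.ofReal_pow (norm_nonneg _), ofReal_norm, mul_assoc, RCLike.enorm_conj]
      · simp [W, hx]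
    have hfin : ∫⁻ x in O, ENNReal.ofReal (|(T' x).det|⁻¹) * ‖φ x‖ₑ ^ 2 ≠ ⊤ := by
      rw [hI]
      refine ne_top_of_le_ne_top ?_ (lintegral_mono (hW1 ℓ))
      rw [lintegral_const_mul'' _ hum, hun]
      exact ENNReal.mul_ne_top ENNReal.ofReal_ne_top ENNReal.ofReal_ne_top
    rw [← hI, ← aux_cv O hOm T T' hT' hTinj hbox hdet φ hφ.integrableOn hfin]
    refine tsum_congr fun k => ?_
    congr 2
    rw [L2.inner_def]
    have h2 : ∫ h, @inner ℂ _ _ (u h) (((hgL (ℓ, k)).toLp _ : Lp ℂ 2 volume) h) =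
        ∫ h, g0 k ((ℓ : Fin r → ℝ) + h) * (starRingEnd ℂ) (u h) := by
      refine integral_congr_ae ?_
      filter_upwards [(hgL (ℓ, k)).coeFn_toLp] with h hh
      rw [hh, RCLike.inner_apply]
    rw [h2]
    have h1 := integral_add_left_eq_self (μ := (volume : Measure (Fin r → ℝ)))
      (fun x => g0 k x * (starRingEnd ℂ) (u (-(ℓ : Fin r → ℝ) + x))) (ℓ : Fin r → ℝ)
    simp only [neg_add_cancel_left] at h1
    rw [h1, ← integral_indicator hOm]
    refine integral_congr_ae (Filter.Eventually.of_forall fun x => ?_)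
    by_cases hx : x ∈ O
    · simp only [indicator_of_mem hx, g0, φ, ← hE]
      ring
    · simp [g0, hx]
  have htot : ∑' p : range ι × (Fin r → ℤ), ‖@inner ℂ _ _ u ((hgL p).toLp _)‖ₑ ^ 2 =
      ∫⁻ h, (∑' n : Fin r → ℤ, W (ι n + h)) * ‖u h‖ₑ ^ 2 := by
    rw [ENNReal.tsum_prod']
    rw [tsum_congr hsum, ← e.tsum_eq]
    rw [← lintegral_tsum]
    · refine lintegral_congr fun h => ?_
      rw [ENNReal.tsum_mul_right]
      rfl
    · intro n
      exact (hWm.comp (measurable_const_add _)).aemeasurable.mul hum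
  have hlow : ENNReal.ofReal (c * ‖u‖ ^ 2) ≤
      ∑' p : range ι × (Fin r → ℤ), ‖@inner ℂ _ _ u ((hgL p).toLp _)‖ₑ ^ 2 := by
    rw [htot, ENNReal.ofReal_mul hc0.le, ← hun, ← lintegral_const_mul'' _ hum]
    exact lintegral_mono fun h => mul_le_mul_left (hN h).1 _
  have hupp : ∑' p : range ι × (Fin r → ℤ), ‖@inner ℂ _ _ u ((hgL p).toLp _)‖ₑ ^ 2 ≤
      ENNReal.ofReal (N * M * ‖u‖ ^ 2) := by
    rw [htot, ENNReal.ofReal_mul hB0, ← hun, ← lintegral_const_mul'' _ hum,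
      ENNReal.ofReal_mul (Nat.cast_nonneg N), ENNReal.ofReal_natCast]
    exact lintegral_mono fun h => mul_le_mul_left (hN h).2 _
  have hne := ne_top_of_le_ne_top ENNReal.ofReal_ne_top hupp
  have hterm : ∀ p : range ι × (Fin r → ℤ), (‖@inner ℂ _ _ u ((hgL p).toLp _)‖ₑ ^ 2).toReal =
      ‖@inner ℂ _ _ u ((hgL p).toLp _)‖ ^ 2 := by
    intro p
    rw [ENNReal.toReal_pow, toReal_enorm]
  have hts := ENNReal.tsum_toReal_eq (ENNReal.ne_top_of_tsum_ne_top hne)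
  simp only [hterm] at hts
  refine ⟨?_, ?_, ?_⟩
  · have := ENNReal.summable_toReal hne
    simpa only [hterm] using this
  · rw [← hts]
    exact (ENNReal.ofReal_le_iff_le_toReal hne).1 hlow
  · rw [← hts]
    have h1 := ENNReal.toReal_le_of_le_ofReal (by positivity) hupp
    have h2 : 0 ≤ c * ‖u‖ ^ 2 := by positivity
    linarith
end

section
/- Let r ≥ 1, let O ⊆ ℝʳ be a bounded open neighborhood of 0, and let Θ : O → ℝʳ be an injective C¹ map with det DΘ(h) ≠ 0 for every h ∈ O and with Θ(O) bounded. Then there exist a continuous function f : ℝʳ → ℂ with compact support contained in O, a countable set Λ ⊆ ℝʳ, and ς > 0 with Θ(O) ⊆ [-ς, ς)ʳ, such that the family g_{ℓ,k}(h) = (2ς)^{-r/2} · exp( 2πi ⟨Θ(ℓ + h), k⟩ / (2ς) ) · f(ℓ + h) (set to 0 when ℓ + h ∉ O), indexed by (ℓ, k) ∈ Λ × ℤʳ, is a Parseval frame for L²(ℝʳ): ∑_{(ℓ,k) ∈ Λ × ℤʳ} |⟨g, g_{ℓ,k}⟩|² = ‖g‖² for every g ∈ L²(ℝʳ). -/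
open MeasureTheory

theorem unit_parseval (r : ℕ) (G : (Fin r → ℝ) → ℂ)
    (Q : Set (Fin r → ℝ)) (hQ : Q = {x | ∀ i, x i ∈ Set.Ioc (-(1/2) : ℝ) (-(1/2) + 1)})
    (hG : MemLp G 2 (volume.restrict Q)) :
    HasSum (fun k : Fin r → ℤ => ‖∫ x in Q,
        Complex.exp (2 * Real.pi * Complex.I * ((∑ j, x j * (k j : ℝ) : ℝ) : ℂ)) * G x‖ ^ 2)
      (∫ x in Q, ‖G x‖ ^ 2) := by
  -- the normalised measure on the circle, as in the Mathlib file on multivariate Fourier series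
  letI : MeasureSpace UnitAddCircle := ⟨AddCircle.haarAddCircle⟩
  haveI : IsProbabilityMeasure (volume : Measure UnitAddCircle) :=
    inferInstanceAs (IsProbabilityMeasure AddCircle.haarAddCircle)
  subst hQ
  set a : Fin r → ℝ := fun _ => -(1/2) with ha
  set e := UnitAddTorus.measurableEquivPiIoc a with he
  have hmp := UnitAddTorus.measurePreserving_equivPiIoc a
  have hQm : MeasurableSet {x : Fin r → ℝ | ∀ i, x i ∈ Set.Ioc (a i) (a i + 1)} :=
    MeasurableSet.univ_pi' (fun i => measurableSet_Ioc)
  have hmp2 : MeasurePreserving (fun t : UnitAddTorus (Fin r) => (e t).1) volume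
      (volume.restrict {x : Fin r → ℝ | ∀ i, x i ∈ Set.Ioc (a i) (a i + 1)}) := by
    refine MeasurePreserving.comp (g := Subtype.val) ⟨measurable_subtype_coe, ?_⟩ hmp
    exact map_comap_subtype_coe hQm volume
  have hF : MemLp (fun t : UnitAddTorus (Fin r) => G (e t).1) 2 volume :=
    hG.comp_measurePreserving hmp2
  have key : ∀ x ∈ {x : Fin r → ℝ | ∀ i, x i ∈ Set.Ioc (a i) (a i + 1)},
      G (e (fun i => (x i : UnitAddCircle))).1 = G x := by
    intro x hx
    have : (fun i => (x i : UnitAddCircle)) = e.symm ⟨x, hx⟩ := rfl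
    rw [this, MeasurableEquiv.apply_symm_apply]
  have h1 := UnitAddTorus.hasSum_sq_mFourierCoeff hF.toLp
  have hco : ∀ n, UnitAddTorus.mFourierCoeff hF.toLp n =
      ∫ x in {x : Fin r → ℝ | ∀ i, x i ∈ Set.Ioc (a i) (a i + 1)},
        UnitAddTorus.mFourier (-n) (fun i => (x i : UnitAddCircle)) * G x := by
    intro n
    have : UnitAddTorus.mFourierCoeff hF.toLp n
        = UnitAddTorus.mFourierCoeff (fun t : UnitAddTorus (Fin r) => G (e t).1) n := by
      unfold UnitAddTorus.mFourierCoeff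
      refine integral_congr_ae ?_
      filter_upwards [hF.coeFn_toLp] with t ht
      rw [ht]
    rw [this, UnitAddTorus.mFourierCoeff_eq_integral _ n a]
    refine setIntegral_congr_fun hQm fun x hx => ?_
    simp only [smul_eq_mul]
    rw [key x hx]
  have hint : ∫ t, ‖(hF.toLp : UnitAddTorus (Fin r) → ℂ) t‖ ^ 2 =
      ∫ x in {x : Fin r → ℝ | ∀ i, x i ∈ Set.Ioc (a i) (a i + 1)}, ‖G x‖ ^ 2 := by
    have : ∫ t, ‖(hF.toLp : UnitAddTorus (Fin r) → ℂ) t‖ ^ 2 = ∫ t, ‖G (e t).1‖ ^ 2 := by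
      refine integral_congr_ae ?_
      filter_upwards [hF.coeFn_toLp] with t ht
      rw [ht]
    rw [this, UnitAddTorus.integral_preimage _ a]
    refine setIntegral_congr_fun hQm fun x hx => ?_
    rw [key x hx]
  rw [hint] at h1
  have h2 := (Equiv.neg (Fin r → ℤ)).hasSum_iff.mpr h1
  refine h2.congr_fun fun k => ?_
  simp only [Function.comp, Equiv.neg_apply, hco, neg_neg]
  congr 2
  refine setIntegral_congr_fun hQm fun x hx => ?_
  congr 1
  simp only [UnitAddTorus.mFourier, ContinuousMap.coe_mk, fourier_coe_apply]
  rw [← Complex.exp_sum]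
  congr 1
  push_cast
  rw [Finset.mul_sum]
  refine Finset.sum_congr rfl fun j _ => ?_
  simp
  ring

theorem jac_parseval (r : ℕ) (O : Set (Fin r → ℝ)) (hO : MeasurableSet O)
    (Φ : (Fin r → ℝ) → (Fin r → ℝ)) (Φ' : (Fin r → ℝ) → (Fin r → ℝ) →L[ℝ] (Fin r → ℝ))
    (hΦ : ∀ x ∈ O, HasFDerivWithinAt Φ (Φ' x) O x) (hinj : Set.InjOn Φ O)
    (hdet : ∀ x ∈ O, (Φ' x).det ≠ 0)
    (hsub : ∀ x ∈ O, ∀ i, Φ x i ∈ Set.Ioc (-(1/2) : ℝ) (-(1/2) + 1))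
    (w : (Fin r → ℝ) → ℂ) (hw : IntegrableOn w O)
    (hw2 : IntegrableOn (fun x => ‖w x‖ ^ 2 / |(Φ' x).det|) O) :
    HasSum (fun k : Fin r → ℤ => ‖∫ x in O,
        Complex.exp (2 * Real.pi * Complex.I * ((∑ j, Φ x j * (k j : ℝ) : ℝ) : ℂ)) * w x‖ ^ 2)
      (∫ x in O, ‖w x‖ ^ 2 / |(Φ' x).det|) := by
  set Q : Set (Fin r → ℝ) := {x | ∀ i, x i ∈ Set.Ioc (-(1/2) : ℝ) (-(1/2) + 1)} with hQ
  have hIQ : Φ '' O ⊆ Q := by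
    rintro _ ⟨x, hx, rfl⟩
    exact hsub x hx
  set G0 : (Fin r → ℝ) → ℂ := fun y =>
    w (Function.invFunOn Φ O y) / ((|(Φ' (Function.invFunOn Φ O y)).det| : ℝ) : ℂ) with hG0
  have hG0Φ : ∀ x ∈ O, G0 (Φ x) = w x / ((|(Φ' x).det| : ℝ) : ℂ) := by
    intro x hx
    simp only [hG0]
    rw [hinj.leftInvOn_invFunOn hx]
  have hIm : MeasurableSet (Φ '' O) := measurable_image_of_fderivWithin hO hΦ hinj
  have hpos : ∀ x ∈ O, 0 < |(Φ' x).det| := fun x hx => abs_pos.mpr (hdet x hx)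
  have e1 : ∀ x ∈ O, |(Φ' x).det| • G0 (Φ x) = w x := by
    intro x hx
    have : ((|(Φ' x).det| : ℝ) : ℂ) ≠ 0 := by exact_mod_cast (hpos x hx).ne'
    rw [hG0Φ x hx, Complex.real_smul]
    field_simp
  have e2 : ∀ x ∈ O, |(Φ' x).det| • ‖G0 (Φ x)‖ ^ 2 = ‖w x‖ ^ 2 / |(Φ' x).det| := by
    intro x hx
    have := (hpos x hx).ne'
    rw [hG0Φ x hx, norm_div, Complex.norm_real, Real.norm_eq_abs, abs_abs, smul_eq_mul]
    field_simp
  have hGi : IntegrableOn G0 (Φ '' O) := by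
    rw [integrableOn_image_iff_integrableOn_abs_det_fderiv_smul volume hO hΦ hinj]
    exact hw.congr_fun (fun x hx => (e1 x hx).symm) hO
  have hGi2 : IntegrableOn (fun y => ‖G0 y‖ ^ 2) (Φ '' O) := by
    rw [integrableOn_image_iff_integrableOn_abs_det_fderiv_smul volume hO hΦ hinj]
    exact hw2.congr_fun (fun x hx => (e2 x hx).symm) hO
  have hmem0 : MemLp G0 2 (volume.restrict (Φ '' O)) :=
    (memLp_two_iff_integrable_sq_norm hGi.aestronglyMeasurable).mpr hGi2
  have hmem : MemLp ((Φ '' O).indicator G0) 2 (volume.restrict Q) := by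
    rw [memLp_indicator_iff_restrict hIm, Measure.restrict_restrict hIm,
      Set.inter_eq_self_of_subset_left hIQ]
    exact hmem0
  have h := unit_parseval r _ Q hQ hmem
  convert! h using 1
  · funext k
    congr 2
    have : ∀ x, Complex.exp (2 * Real.pi * Complex.I * ((∑ j, x j * (k j : ℝ) : ℝ) : ℂ)) *
        (Φ '' O).indicator G0 x = (Φ '' O).indicator (fun x =>
        Complex.exp (2 * Real.pi * Complex.I * ((∑ j, x j * (k j : ℝ) : ℝ) : ℂ)) * G0 x) x := by
      intro x
      by_cases hx : x ∈ Φ '' O <;> simp [hx]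
    simp_rw [this]
    rw [setIntegral_indicator hIm, Set.inter_eq_self_of_subset_right hIQ,
      integral_image_eq_integral_abs_det_fderiv_smul volume hO hΦ hinj]
    refine setIntegral_congr_fun hO fun x hx => ?_
    rw [← mul_smul_comm, e1 x hx]
  · have : ∀ x, ‖(Φ '' O).indicator G0 x‖ ^ 2
        = (Φ '' O).indicator (fun x => ‖G0 x‖ ^ 2) x := by
      intro x
      by_cases hx : x ∈ Φ '' O <;> simp [hx]
    simp_rw [this]
    rw [setIntegral_indicator hIm, Set.inter_eq_self_of_subset_right hIQ,
      integral_image_eq_integral_abs_det_fderiv_smul volume hO hΦ hinj]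
    exact setIntegral_congr_fun hO fun x hx => (e2 x hx).symm


theorem tent_sum (t : ℝ) (s : Finset ℤ) (hs : s = {-⌊t⌋, -⌊t⌋ - 1}) :
    (∑ n ∈ s, max 0 (1 - |t + n|) = 1) ∧ ∀ n ∉ s, max 0 (1 - |t + (n : ℤ)|) = 0 := by
  subst hs
  have h1 := Int.floor_le t
  have h2 := Int.lt_floor_add_one t
  constructor
  · rw [Finset.sum_pair (by omega)]
    push_cast
    rw [abs_of_nonneg (by linarith), abs_of_nonpos (by linarith), max_eq_right (by linarith),
      max_eq_right (by linarith)]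
    ring
  · intro n hn
    simp only [Finset.mem_insert, Finset.mem_singleton, not_or] at hn
    apply max_eq_left
    have : n + ⌊t⌋ ≥ 1 ∨ n + ⌊t⌋ ≤ -2 := by omega
    rcases this with h | h
    · have : (n : ℝ) + ⌊t⌋ ≥ 1 := by exact_mod_cast h
      have := le_abs_self (t + n)
      linarith
    · have : (n : ℝ) + ⌊t⌋ ≤ -2 := by exact_mod_cast h
      have := neg_le_abs (t + n)
      linarith

theorem tent_hasSum (r : ℕ) (t : Fin r → ℝ) :
    HasSum (fun n : Fin r → ℤ => ∏ j, max 0 (1 - |t j + n j|)) 1 := by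
  set s : Fin r → Finset ℤ := fun j => {-⌊t j⌋, -⌊t j⌋ - 1} with hs
  have h := hasSum_sum_of_ne_finset_zero (L := SummationFilter.unconditional _) (f := fun n : Fin r → ℤ => ∏ j, max 0 (1 - |t j + n j|))
    (s := Fintype.piFinset s) (by
      intro n hn
      rw [Fintype.mem_piFinset] at hn
      push Not at hn
      obtain ⟨j, hj⟩ := hn
      exact Finset.prod_eq_zero (Finset.mem_univ j) ((tent_sum (t j) (s j) rfl).2 _ hj))
  rw [← Finset.prod_univ_sum s (fun j (n : ℤ) => max 0 (1 - |t j + n|))] at h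
  rw [Finset.prod_eq_one (fun j _ => (tent_sum (t j) (s j) rfl).1)] at h
  exact h

/-- square partition of unity -/
theorem exists_square_pou (r : ℕ) (O : Set (Fin r → ℝ)) (hO : IsOpen O) (h0 : 0 ∈ O) :
    ∃ (s : (Fin r → ℝ) → ℝ) (Λ : Set (Fin r → ℝ)), Continuous s ∧ HasCompactSupport s ∧
      tsupport s ⊆ O ∧ Λ.Countable ∧ ∀ x, HasSum (fun l : Λ => s (l + x) ^ 2) 1 := by
  obtain ⟨ε, hε, hball⟩ := Metric.isOpen_iff.mp hO 0 h0
  obtain ⟨δ, hδ, hδε⟩ := exists_between hε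
  have hsub : tsupport (fun x : Fin r → ℝ => Real.sqrt (∏ j, max 0 (1 - |x j / δ|)))
      ⊆ Metric.closedBall 0 δ := by
    refine closure_minimal ?_ Metric.isClosed_closedBall
    intro x hx
    rw [mem_closedBall_zero_iff, pi_norm_le_iff_of_nonneg hδ.le]
    by_contra! hcon
    obtain ⟨j, hj⟩ := hcon
    apply hx
    simp only
    rw [Finset.prod_eq_zero (Finset.mem_univ j), Real.sqrt_zero]
    apply max_eq_left
    rw [abs_div, abs_of_pos hδ]
    have : 1 ≤ |x j| / δ := by
      rw [le_div_iff₀ hδ]; rw [Real.norm_eq_abs] at hj; linarith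
    linarith
  have hinj : Function.Injective (fun n : Fin r → ℤ => fun j => δ * (n j : ℝ)) := by
    intro n m h
    funext j
    have := congrFun h j
    simp only at this
    exact_mod_cast mul_left_cancel₀ hδ.ne' this
  refine ⟨fun x => Real.sqrt (∏ j, max 0 (1 - |x j / δ|)),
    Set.range (fun n : Fin r → ℤ => fun j => δ * (n j : ℝ)), ?_, ?_, ?_, ?_, ?_⟩
  · fun_prop
  · exact (isCompact_closedBall 0 δ).of_isClosed_subset (isClosed_tsupport _) hsub
  · exact hsub.trans ((Metric.closedBall_subset_ball hδε).trans hball)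
  · exact Set.countable_range _
  · intro x
    rw [← (Equiv.ofInjective _ hinj).hasSum_iff]
    refine (tent_hasSum r (fun j => x j / δ)).congr_fun fun n => ?_
    simp only [Function.comp, Equiv.ofInjective_apply]
    rw [Real.sq_sqrt (Finset.prod_nonneg fun _ _ => le_max_left _ _)]
    refine Finset.prod_congr rfl fun j _ => ?_
    congr 3
    simp only [Pi.add_apply]
    field_simp
    ring

theorem l2_norm_sq {r : ℕ} (u : Lp ℂ 2 (volume : Measure (Fin r → ℝ))) :
    ‖u‖ ^ 2 = ∫ x, ‖u x‖ ^ 2 := by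
  have h : @inner ℂ _ _ u u = ((‖u‖ : ℂ)) ^ 2 := inner_self_eq_norm_sq_to_K u
  rw [L2.inner_def] at h
  have h2 : ∀ x, @inner ℂ _ _ (u x) (u x) = ((‖u x‖ ^ 2 : ℝ) : ℂ) := fun x => by
    rw [inner_self_eq_norm_sq_to_K]; push_cast; rfl
  simp_rw [h2] at h
  rw [integral_complex_ofReal] at h
  exact_mod_cast h.symm

theorem stmt_19 (r : ℕ) (hr : 0 < r)
    (O : Set (Fin r → ℝ)) (hO_open : IsOpen O) (hO_bdd : Bornology.IsBounded O)
    (hO_zero : (0 : Fin r → ℝ) ∈ O)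
    (Θ : (Fin r → ℝ) → (Fin r → ℝ)) (hΘ_inj : Set.InjOn Θ O)
    (hΘ_C1 : ContDiffOn ℝ 1 Θ O)
    (hΘ_det : ∀ h ∈ O, (fderivWithin ℝ Θ O h).det ≠ 0)
    (hΘO_bdd : Bornology.IsBounded (Θ '' O)) :
    ∃ (f : (Fin r → ℝ) → ℂ) (Λ : Set (Fin r → ℝ)) (ς : ℝ),
      Continuous f ∧ HasCompactSupport f ∧ tsupport f ⊆ O ∧
      Λ.Countable ∧ 0 < ς ∧
      Θ '' O ⊆ (Set.univ.pi fun _ : Fin r => Set.Ico (-ς) ς) ∧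
      ∃ g : Λ × (Fin r → ℤ) → Lp ℂ 2 (volume : Measure (Fin r → ℝ)),
        (∀ p : Λ × (Fin r → ℤ), ⇑(g p) =ᵐ[(volume : Measure (Fin r → ℝ))]
          fun h : Fin r → ℝ => Set.indicator O
            (fun x => (↑(((2 * ς) ^ r) ^ (-(1 / 2 : ℝ))) : ℂ) *
                Complex.exp (2 * Real.pi * Complex.I *
                  (↑(∑ j, Θ x j * ((p.2 j : ℤ) : ℝ)) : ℂ) / (↑(2 * ς) : ℂ)) * f x)
            (↑p.1 + h)) ∧
        ∀ u : Lp ℂ 2 (volume : Measure (Fin r → ℝ)),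
          Summable (fun p : Λ × (Fin r → ℤ) => ‖@inner ℂ _ _ u (g p)‖ ^ 2) ∧
          (∑' p : Λ × (Fin r → ℤ), ‖@inner ℂ _ _ u (g p)‖ ^ 2) = ‖u‖ ^ 2 := by
  classical
  obtain ⟨s, Λ, hs_cont, hs_comp, hs_supp, hΛ, hsum⟩ := exists_square_pou r O hO_open hO_zero
  obtain ⟨M, hM⟩ := hΘO_bdd.exists_norm_le
  set ς : ℝ := |M| + 1 with hς
  have hς0 : 0 < ς := by positivity
  have hΘlt : ∀ x ∈ O, ∀ i, |Θ x i| < ς := by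
    intro x hx i
    have h1 := hM (Θ x) ⟨x, hx, rfl⟩
    have h2 := norm_le_pi_norm (Θ x) i
    rw [Real.norm_eq_abs] at h2
    have := le_abs_self M
    linarith
  have hOm := hO_open.measurableSet
  set D : (Fin r → ℝ) → ℝ := fun x => |(fderivWithin ℝ Θ O x).det| with hD
  have hDcont : ContinuousOn D O :=
    (ContinuousLinearMap.continuous_det.comp_continuousOn
      (hΘ_C1.continuousOn_fderivWithin hO_open.uniqueDiffOn le_rfl)).abs
  have hDpos : ∀ x ∈ O, 0 < D x := fun x hx => abs_pos.mpr (hΘ_det x hx)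
  set f : (Fin r → ℝ) → ℂ := fun x => ((s x * Real.sqrt (D x) : ℝ) : ℂ) with hf
  have hf_supp : tsupport f ⊆ tsupport s := by
    refine closure_mono fun x hx => ?_
    intro hx0
    apply hx
    simp [hf, hx0]
  have hf_cont : Continuous f := by
    refine ContinuousOn.continuous_of_tsupport_subset (s := O) ?_ hO_open (hf_supp.trans hs_supp)
    exact Complex.continuous_ofReal.comp_continuousOn (hs_cont.continuousOn.mul hDcont.sqrt)
  have hf_comp : HasCompactSupport f := hs_comp.of_isClosed_subset (isClosed_tsupport _) hf_supp
  have hs0 : ∀ x, x ∉ O → s x = 0 := fun x hx => by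
    by_contra h
    exact hx (hs_supp (subset_tsupport _ h))
  have hf2 : MemLp f 2 volume := hf_cont.memLp_of_hasCompactSupport hf_comp
  set c : ℝ := ((2 * ς) ^ r) ^ (-(1 / 2 : ℝ)) with hc
  have hc2 : c ^ 2 = ((2 * ς)⁻¹) ^ r := by
    rw [hc, ← Real.rpow_natCast, ← Real.rpow_mul (by positivity)]
    have : (-(1 / 2 : ℝ)) * ((2 : ℕ) : ℝ) = -1 := by norm_num
    rw [this, Real.rpow_neg_one, inv_pow]
  set F : (Fin r → ℤ) → (Fin r → ℝ) → ℂ := fun k => Set.indicator O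
            (fun x => (↑c : ℂ) *
                Complex.exp (2 * Real.pi * Complex.I *
                  (↑(∑ j, Θ x j * ((k j : ℤ) : ℝ)) : ℂ) / (↑(2 * ς) : ℂ)) * f x) with hF
  have hΘc : ContinuousOn Θ O := hΘ_C1.continuousOn
  have hFmem : ∀ k, MemLp (F k) 2 volume := by
    intro k
    refine (hf2.const_mul (c : ℂ)).of_le ?_ ?_
    · rw [hF, aestronglyMeasurable_indicator_iff hOm]
      refine ContinuousOn.aestronglyMeasurable ?_ hOm
      have : ∀ j, ContinuousOn (fun x => Θ x j) O := fun j =>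
        (continuous_apply j).comp_continuousOn hΘc
      fun_prop
    · refine Filter.Eventually.of_forall fun x => ?_
      by_cases hx : x ∈ O
      · simp only [hF, Set.indicator_of_mem hx, norm_mul]
        have : 2 * Real.pi * Complex.I *
            (↑(∑ j, Θ x j * ((k j : ℤ) : ℝ)) : ℂ) / (↑(2 * ς) : ℂ)
            = ((2 * Real.pi * (∑ j, Θ x j * ((k j : ℤ) : ℝ)) / (2 * ς) : ℝ) : ℂ) * Complex.I := by
          push_cast; ring
        rw [this, Complex.norm_exp_ofReal_mul_I, mul_one]
      · simp only [hF, Set.indicator_of_notMem hx, norm_zero]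
        positivity
  have hgmem : ∀ p : Λ × (Fin r → ℤ),
      MemLp (fun h => F p.2 ((p.1 : Fin r → ℝ) + h)) 2 volume := fun p =>
    (hFmem p.2).comp_measurePreserving (measurePreserving_add_left volume (p.1 : Fin r → ℝ))
  refine ⟨f, Λ, ς, hf_cont, hf_comp, hf_supp.trans hs_supp, hΛ, hς0, ?_,
    fun p => (hgmem p).toLp, fun p => (hgmem p).coeFn_toLp, ?_⟩
  · rintro _ ⟨x, hx, rfl⟩ i -
    have := abs_lt.mp (hΘlt x hx i)
    exact ⟨this.1.le, this.2⟩
  intro u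
  have : Countable Λ := hΛ.to_subtype
  have huL := Lp.memLp u
  have hu2 : Integrable (fun h => ‖u h‖ ^ 2) volume := huL.integrable_norm_pow (by norm_num)
  have hs1 : ∀ (l : Λ) x, s (l + x) ^ 2 ≤ 1 := fun l x =>
    le_hasSum (hsum x) l fun _ _ => sq_nonneg _
  have hAi : ∀ l : Λ, Integrable (fun h => s (l + h) ^ 2 * ‖u h‖ ^ 2) volume := by
    intro l
    refine hu2.mono' ?_ (Filter.Eventually.of_forall fun x => ?_)
    · refine AEStronglyMeasurable.mul ?_ hu2.aestronglyMeasurable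
      exact Continuous.aestronglyMeasurable (by fun_prop)
    · rw [Real.norm_of_nonneg (by positivity)]
      have := hs1 l x
      nlinarith [sq_nonneg ‖u x‖]
  have hA : HasSum (fun l : Λ => ∫ h, s (l + h) ^ 2 * ‖u h‖ ^ 2) (‖u‖ ^ 2) := by
    rw [l2_norm_sq]
    have hp : ∀ x, HasSum (fun l : Λ => s (l + x) ^ 2 * ‖u x‖ ^ 2) (‖u x‖ ^ 2) := fun x => by
      simpa using (hsum x).mul_right (‖u x‖ ^ 2)
    refine hasSum_integral_of_dominated_convergence (fun l h => s (l + h) ^ 2 * ‖u h‖ ^ 2)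
      (fun l => (hAi l).aestronglyMeasurable) (fun l => Filter.Eventually.of_forall fun x => ?_)
      (Filter.Eventually.of_forall fun x => (hp x).summable) ?_ (Filter.Eventually.of_forall hp)
    · rw [Real.norm_of_nonneg (by positivity)]
    · simp_rw [fun x => (hp x).tsum_eq]
      exact hu2
  have hB : ∀ l : Λ, HasSum (fun k : Fin r → ℤ => ‖@inner ℂ _ _ u ((hgmem (l, k)).toLp)‖ ^ 2)
      (∫ h, s (l + h) ^ 2 * ‖u h‖ ^ 2) := by
    intro l
    have hul : MemLp (fun x => u (-(l : Fin r → ℝ) + x)) 2 volume :=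
      huL.comp_measurePreserving (measurePreserving_add_left volume (-(l : Fin r → ℝ)))
    set w : (Fin r → ℝ) → ℂ := fun x =>
      (c : ℂ) * (f x * (starRingEnd ℂ) (u (-(l : Fin r → ℝ) + x))) with hw
    have hwi : Integrable w volume := by
      refine Integrable.const_mul ?_ _
      exact hf2.integrable_mul hul.star
    set Φ' : (Fin r → ℝ) → (Fin r → ℝ) →L[ℝ] (Fin r → ℝ) :=
      fun x => (2 * ς)⁻¹ • fderivWithin ℝ Θ O x with hΦ'
    have hdet : ∀ x, (Φ' x).det = ((2 * ς)⁻¹) ^ r * (fderivWithin ℝ Θ O x).det := by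
      intro x
      simp [hΦ', ContinuousLinearMap.det, LinearMap.det_smul]
    have hwn : ∀ x ∈ O, ‖w x‖ ^ 2 / |(Φ' x).det|
        = s x ^ 2 * ‖u (-(l : Fin r → ℝ) + x)‖ ^ 2 := by
      intro x hx
      have hDx := hDpos x hx
      have hp : 0 < ((2 * ς)⁻¹) ^ r := by positivity
      rw [hdet, abs_mul, abs_of_pos hp]
      change _ / (_ * D x) = _
      simp only [hw, hf, norm_mul, Complex.norm_real, RCLike.norm_conj, mul_pow, Real.norm_eq_abs,
        sq_abs, Real.sq_sqrt hDx.le, hc2]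
      rw [div_eq_iff (by positivity)]
      simp only [← mul_pow]
      ring
    have hCi : Integrable (fun x => s x ^ 2 * ‖u (-(l : Fin r → ℝ) + x)‖ ^ 2) volume := by
      simpa using (hAi l).comp_add_left (-(l : Fin r → ℝ))
    have hJ := jac_parseval r O hOm (fun x => (2 * ς)⁻¹ • Θ x) Φ'
      (fun x hx => ((hΘ_C1.differentiableOn (by norm_num) x hx).hasFDerivWithinAt).const_smul (2 * ς)⁻¹)
      (fun x hx y hy hxy => hΘ_inj hx hy (smul_right_injective _ (by positivity) hxy))
      (fun x hx => by rw [hdet]; exact mul_ne_zero (by positivity) (hΘ_det x hx))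
      (fun x hx i => by
        have := abs_lt.mp (hΘlt x hx i)
        simp only [Pi.smul_apply, smul_eq_mul, Set.mem_Ioc]
        rw [inv_mul_eq_div]
        constructor
        · rw [lt_div_iff₀ (by positivity)]; linarith
        · rw [div_le_iff₀ (by positivity)]; linarith)
      w hwi.integrableOn
      (hCi.integrableOn.congr_fun (fun x hx => (hwn x hx).symm) hOm)
    convert! hJ using 1
    · funext k
      congr 2
      rw [L2.inner_def]
      have e1 : ∫ h, @inner ℂ _ _ (u h) (((hgmem (l, k)).toLp : (Fin r → ℝ) → ℂ) h)
          = ∫ h, (fun x => @inner ℂ _ _ (u (-(l : Fin r → ℝ) + x)) (F k x)) ((l : Fin r → ℝ) + h) := by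
        refine integral_congr_ae ?_
        filter_upwards [(hgmem (l, k)).coeFn_toLp] with h hh
        simp only [hh, neg_add_cancel_left]
      rw [e1, integral_add_left_eq_self
        (fun x => @inner ℂ _ _ (u (-(l : Fin r → ℝ) + x)) (F k x)) (l : Fin r → ℝ),
        ← integral_indicator hOm]
      refine integral_congr_ae (Filter.Eventually.of_forall fun x => ?_)
      by_cases hx : x ∈ O
      · simp only [hF, Set.indicator_of_mem hx, hw, RCLike.inner_apply]
        have : 2 * Real.pi * Complex.I *
            (↑(∑ j, Θ x j * ((k j : ℤ) : ℝ)) : ℂ) / (↑(2 * ς) : ℂ)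
            = 2 * Real.pi * Complex.I *
            (↑(∑ j, ((2 * ς)⁻¹ • Θ x) j * ((k j : ℤ) : ℝ)) : ℂ) := by
          simp only [Pi.smul_apply, smul_eq_mul, mul_assoc, ← Finset.mul_sum]
          push_cast
          ring
        rw [this]
        ring
      · simp only [hF, Set.indicator_of_notMem hx, inner_zero_right]
    · rw [setIntegral_congr_fun hOm hwn, setIntegral_eq_integral_of_forall_compl_eq_zero
        (fun x hx => by rw [hs0 x hx]; simp),
        ← integral_add_left_eq_self
          (fun x => s x ^ 2 * ‖u (-(l : Fin r → ℝ) + x)‖ ^ 2) (l : Fin r → ℝ)]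
      simp only [neg_add_cancel_left]
  have hS : Summable (fun p : Λ × (Fin r → ℤ) => ‖@inner ℂ _ _ u ((hgmem p).toLp)‖ ^ 2) := by
    rw [summable_prod_of_nonneg (fun _ => sq_nonneg _)]
    refine ⟨fun l => (hB l).summable, ?_⟩
    simp_rw [fun l => (hB l).tsum_eq]
    exact hA.summable
  refine ⟨hS, ?_⟩
  rw [hS.tsum_prod]
  simp_rw [fun l => (hB l).tsum_eq]
  exact hA.tsum_eq
end
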